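/- arXiv:0810.1853 — 3 statements merged into one kernel-verified Lean document; each statement's English description precedes it below -/
import Mathlib

section
/- Let x, y ∈ GL_n(F) over a field F. If there exist h₁, h₂ ∈ Sp_{2n}(F) with h₁ · diag(x, I_n) · h₂⁻¹ = diag(y, I_n), then x and y are conjugate in GL_n(F). -/
open Matrix

noncomputable def JmatF (n : ℕ) (F : Type*) [Field F] :
    Matrix (Fin n ⊕ Fin n) (Fin n ⊕ Fin n) F :=
  Matrix.fromBlocks 0 1 (-1) 0

open Polynomial

noncomputable def kdim (F : Type*) [Field F] (M : Type*) [AddCommGroup M] [Module F M]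
    [Module F[X] M] [IsScalarTower F F[X] M] (q : F[X]) : ℕ :=
  Module.finrank F (LinearMap.ker (Algebra.lsmul F F M q))

universe u v
section
variable {F : Type*} [Field F]

lemma kdim_congr {M N : Type*} [AddCommGroup M] [Module F M]
    [Module F[X] M] [IsScalarTower F F[X] M] [AddCommGroup N] [Module F N]
    [Module F[X] N] [IsScalarTower F F[X] N] (e : M ≃ₗ[F[X]] N) (q : F[X]) :
    kdim F M q = kdim F N q := by
  let e' : M ≃ₗ[F] N := e.restrictScalars F
  have h : ∀ m, e' m = e m := fun m => rfl
  refine LinearEquiv.finrank_eq (e'.ofSubmodules _ _ ?_)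
  ext n
  simp only [Submodule.mem_map, LinearMap.mem_ker, Algebra.lsmul_coe]
  constructor
  · rintro ⟨m, hm, rfl⟩
    change q • e m = 0
    rw [← map_smul, hm, map_zero]
  · intro hn
    refine ⟨e.symm n, ?_, e.apply_symm_apply n⟩
    rw [← map_smul, hn, map_zero]

lemma kdim_pi {ι : Type*} [Fintype ι] (M : ι → Type*) [∀ i, AddCommGroup (M i)]
    [∀ i, Module F (M i)] [∀ i, Module F[X] (M i)] [∀ i, IsScalarTower F F[X] (M i)]
    [∀ i, Module.Finite F (M i)] (q : F[X]) :
    kdim F (∀ i, M i) q = ∑ i, kdim F (M i) q := by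
  unfold kdim
  rw [← Module.finrank_pi_fintype F]
  refine LinearEquiv.finrank_eq
    { toFun := fun v i => ⟨v.1 i, ?_⟩
      invFun := fun v => ⟨fun i => (v i).1, ?_⟩
      map_add' := fun _ _ => rfl
      map_smul' := fun _ _ => rfl
      left_inv := fun _ => rfl
      right_inv := fun _ => rfl }
  · have := v.2
    rw [LinearMap.mem_ker, Algebra.lsmul_coe] at this ⊢
    exact congrFun this i
  · rw [LinearMap.mem_ker, Algebra.lsmul_coe]
    funext i
    exact (v i).2

lemma finite_quot (a : F[X]) (ha : a ≠ 0) : Module.Finite F (F[X] ⧸ Ideal.span {a}) := by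
  have : Module.Finite F (AdjoinRoot a) := (AdjoinRoot.powerBasis ha).finite
  exact this

lemma kdim_quot (a q g : F[X]) (ha : a ≠ 0)
    (hg : Ideal.span {a} ⊔ Ideal.span {q} = Ideal.span {g}) :
    kdim F (F[X] ⧸ Ideal.span {a}) q = g.natDegree := by
  have := finite_quot a ha
  have h1 := LinearMap.finrank_range_add_finrank_ker (Algebra.lsmul F F (F[X] ⧸ Ideal.span {a}) q)
  have h2 := Submodule.finrank_quotient_add_finrank
    (LinearMap.range (Algebra.lsmul F F (F[X] ⧸ Ideal.span {a}) q))
  have h3 : Module.finrank F ((F[X] ⧸ Ideal.span {a}) ⧸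
      (LinearMap.range (Algebra.lsmul F F (F[X] ⧸ Ideal.span {a}) q))) = g.natDegree := by
    rw [← finrank_quotient_span_eq_natDegree, ← hg]
    rw [← (DoubleQuot.quotQuotEquivQuotSupₐ F (Ideal.span {a}) (Ideal.span {q})).toLinearEquiv.finrank_eq]
    let J := (Ideal.span {q}).map (Ideal.Quotient.mkₐ F (Ideal.span {a}))
    have hJ : LinearMap.range (Algebra.lsmul F F (F[X] ⧸ Ideal.span {a}) q) =
      J.restrictScalars F := by
      ext z
      simp only [J, Ideal.map_span, Set.image_singleton, LinearMap.mem_range, Algebra.lsmul_coe,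
        Submodule.restrictScalars_mem, Ideal.mem_span_singleton']
      refine exists_congr fun w => ?_
      have : q • w = w * (Ideal.Quotient.mkₐ F (Ideal.span {a})) q := by
        obtain ⟨w, rfl⟩ := Ideal.Quotient.mk_surjective w
        rw [mul_comm]
        rfl
      rw [this]
    rw [hJ]
    exact (Submodule.Quotient.restrictScalarsEquiv F J).finrank_eq
  unfold kdim
  omega

lemma kdim_pow (p r : F[X]) (hp : Irreducible p) (hpm : p.Monic) (hr : Irreducible r)
    (hrm : r.Monic) (e k : ℕ) [Decidable (p = r)] :
    kdim F (F[X] ⧸ Ideal.span {p ^ e}) (r ^ k) =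
      r.natDegree * (if p = r then min e k else 0) := by
  have hp0 : p ^ e ≠ 0 := pow_ne_zero _ hp.ne_zero
  split_ifs with h
  · subst h
    rw [kdim_quot _ _ (p ^ (min e k)) hp0, natDegree_pow, mul_comm]
    rcases le_total e k with h | h
    · rw [min_eq_left h, sup_eq_left]
      exact Ideal.span_singleton_le_span_singleton.2 (pow_dvd_pow _ h)
    · rw [min_eq_right h, sup_eq_right]
      exact Ideal.span_singleton_le_span_singleton.2 (pow_dvd_pow _ h)
  · rw [kdim_quot _ _ 1 hp0, natDegree_one, mul_zero]
    rw [Ideal.span_singleton_one, ← Ideal.isCoprime_iff_sup_eq, Ideal.isCoprime_span_singleton_iff]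
    apply IsCoprime.pow
    refine (hp.coprime_iff_not_dvd).2 fun hd => h ?_
    exact eq_of_monic_of_associated hpm hrm ((hp.dvd_irreducible_iff_associated hr).1 hd)

lemma normal_form {F : Type u} [Field F] (M : Type v) [AddCommGroup M] [Module F[X] M]
    [Module.Finite F[X] M] (hM : Module.IsTorsion F[X] M) :
    ∃ (ι : Type u) (_ : Fintype ι) (key : ι → F[X] × ℕ),
      (∀ i, Irreducible (key i).1 ∧ (key i).1.Monic) ∧
      Nonempty (M ≃ₗ[F[X]] ∀ i, F[X] ⧸ Ideal.span {(key i).1 ^ ((key i).2 + 1)}) := by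
  classical
  obtain ⟨ι, _, p, hp, e, ⟨f⟩⟩ := Module.equiv_directSum_of_isTorsion hM
  let f1 : M ≃ₗ[F[X]] ∀ i, F[X] ⧸ Ideal.span {p i ^ e i} :=
    f.trans (DirectSum.linearEquivFunOnFintype F[X] ι _)
  refine ⟨{i // e i ≠ 0}, inferInstance, fun i => (normalize (p i), e i - 1), fun i =>
    ⟨(normalize_associated (p i)).symm.irreducible (hp i), monic_normalize (hp i).ne_zero⟩, ⟨?_⟩⟩
  let f2 : (∀ i, F[X] ⧸ Ideal.span {p i ^ e i}) ≃ₗ[F[X]]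
      ∀ i : {i // e i ≠ 0}, F[X] ⧸ Ideal.span {p i ^ e i} := by
    have hs : ∀ i, e i = 0 → Subsingleton (F[X] ⧸ Ideal.span {p i ^ e i}) := fun i hi => by
      rw [hi, pow_zero, Ideal.span_singleton_one]
      exact Ideal.Quotient.subsingleton_iff.2 rfl
    refine LinearEquiv.ofBijective
      (LinearMap.pi fun i : {i // e i ≠ 0} => LinearMap.proj i.1) ⟨?_, ?_⟩
    · intro v w h
      funext i
      by_cases hi : e i = 0
      · exact (hs i hi).elim _ _
      · exact congrFun h ⟨i, hi⟩
    · intro v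
      refine ⟨fun i => if hi : e i ≠ 0 then v ⟨i, hi⟩ else 0, ?_⟩
      funext i
      simp [i.2]
  refine (f1.trans f2).trans (LinearEquiv.piCongrRight fun i => Submodule.quotEquivOfEq _ _ ?_)
  have : e i - 1 + 1 = e i := Nat.succ_pred_eq_of_ne_zero i.2
  simp only [this]
  exact Ideal.span_singleton_eq_span_singleton.2 ((normalize_associated (p i)).symm.pow_pow)

lemma equiv_of_kdim {F : Type u} [Field F] (M N : Type*) [AddCommGroup M] [Module F M]
    [Module F[X] M] [IsScalarTower F F[X] M] [AddCommGroup N] [Module F N]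
    [Module F[X] N] [IsScalarTower F F[X] N]
    [Module.Finite F[X] M] (hM : Module.IsTorsion F[X] M)
    [Module.Finite F[X] N] (hN : Module.IsTorsion F[X] N)
    (h : ∀ q, kdim F M q = kdim F N q) : Nonempty (M ≃ₗ[F[X]] N) := by
  classical
  obtain ⟨ι, _, a, ha, ⟨f⟩⟩ := normal_form M hM
  obtain ⟨κ, _, b, hb, ⟨g⟩⟩ := normal_form N hN
  have key : ∀ {ι : Type u} [Fintype ι] (a : ι → F[X] × ℕ)
      (ha : ∀ i, Irreducible (a i).1 ∧ (a i).1.Monic) (r : F[X]) (hr : Irreducible r)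
      (hrm : r.Monic) (k : ℕ), kdim F (∀ i, F[X] ⧸ Ideal.span {(a i).1 ^ ((a i).2 + 1)}) (r ^ k) =
        r.natDegree * ∑ i, if (a i).1 = r then min ((a i).2 + 1) k else 0 := by
    intro ι _ a ha r hr hrm k
    have : ∀ i, Module.Finite F (F[X] ⧸ Ideal.span {(a i).1 ^ ((a i).2 + 1)}) :=
      fun i => finite_quot _ (pow_ne_zero _ (ha i).1.ne_zero)
    rw [kdim_pi, Finset.mul_sum]
    exact Finset.sum_congr rfl fun i _ => kdim_pow _ _ (ha i).1 (ha i).2 hr hrm _ _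
  have comb : ∀ {ι : Type u} [Fintype ι] (a : ι → F[X] × ℕ) (r : F[X]) (k : ℕ),
      Fintype.card {i // a i = (r, k)} + (∑ i, if (a i).1 = r then min ((a i).2 + 1) k else 0)
        + (∑ i, if (a i).1 = r then min ((a i).2 + 1) (k+2) else 0) =
        2 * (∑ i, if (a i).1 = r then min ((a i).2 + 1) (k+1) else 0) := by
    intro ι _ a r k
    rw [Fintype.card_subtype, Finset.card_filter, ← Finset.sum_add_distrib,
      ← Finset.sum_add_distrib, Finset.mul_sum]
    refine Finset.sum_congr rfl fun i _ => ?_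
    simp only [Prod.ext_iff]
    by_cases h1 : (a i).1 = r
    · simp only [h1, true_and, if_true]
      split_ifs <;> omega
    · simp [h1]
  have card : ∀ c : F[X] × ℕ, Fintype.card {i // a i = c} = Fintype.card {i // b i = c} := by
    rintro ⟨r, k⟩
    by_cases hr : Irreducible r ∧ r.Monic
    · have hs : ∀ k, (∑ i, if (a i).1 = r then min ((a i).2 + 1) k else 0) =
          ∑ i, if (b i).1 = r then min ((b i).2 + 1) k else 0 := by
        intro k
        have h1 := h (r ^ k)
        rw [kdim_congr f, kdim_congr g, key a ha r hr.1 hr.2, key b hb r hr.1 hr.2] at h1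
        exact Nat.eq_of_mul_eq_mul_left hr.1.natDegree_pos h1
      have c1 := comb a r k
      have c2 := comb b r k
      rw [hs, hs, hs] at c1
      omega
    · have : IsEmpty {i // a i = (r, k)} := ⟨fun i => hr (by have := ha i.1; rwa [i.2] at this)⟩
      have : IsEmpty {i // b i = (r, k)} := ⟨fun i => hr (by have := hb i.1; rwa [i.2] at this)⟩
      simp
  let σ : ι ≃ κ := Equiv.ofFiberEquiv (f := a) (g := b) fun c => Fintype.equivOfCardEq (card c)
  have hσ : ∀ i, b (σ i) = a i := fun i => Equiv.ofFiberEquiv_map _ i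
  have t1 : (∀ i, F[X] ⧸ Ideal.span {(a i).1 ^ ((a i).2 + 1)}) ≃ₗ[F[X]]
      ∀ i, F[X] ⧸ Ideal.span {(b (σ i)).1 ^ ((b (σ i)).2 + 1)} :=
    LinearEquiv.piCongrRight fun i => Submodule.quotEquivOfEq _ _ (by rw [hσ])
  have t2 := LinearEquiv.piCongrLeft F[X]
    (fun j => F[X] ⧸ Ideal.span {(b j).1 ^ ((b j).2 + 1)}) σ
  exact ⟨((f.trans t1).trans t2).trans g.symm⟩

lemma conj_of_rank {F : Type*} [Field F] (n : ℕ) (x y : Matrix (Fin n) (Fin n) F)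
    (h : ∀ q : F[X], (aeval x q).rank = (aeval y q).rank) :
    ∃ u : Matrix (Fin n) (Fin n) F, IsUnit u.det ∧ u * x * u⁻¹ = y := by
  have tors : ∀ x : Matrix (Fin n) (Fin n) F,
      Module.IsTorsion F[X] (Module.AEval F (Fin n → F) (toLin' x)) := by
    intro x m
    refine ⟨⟨minpoly F (toLin' x), mem_nonZeroDivisors_of_ne_zero
      (minpoly.ne_zero (Algebra.IsIntegral.isIntegral _))⟩, ?_⟩
    apply (Module.AEval.of F (Fin n → F) (toLin' x)).symm.injective
    change (Module.AEval.of F (Fin n → F) (toLin' x)).symm (minpoly F (toLin' x) • m) = _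
    rw [Module.AEval.of_symm_smul, minpoly.aeval, zero_smul, map_zero]
  have kd : ∀ (x : Matrix (Fin n) (Fin n) F) (q : F[X]),
      (aeval x q).rank + kdim F (Module.AEval F (Fin n → F) (toLin' x)) q = n := by
    intro x q
    have h1 := LinearMap.finrank_range_add_finrank_ker (toLin' (aeval x q))
    rw [Module.finrank_fin_fun] at h1
    refine Eq.trans (congrArg₂ (· + ·) rfl ?_) h1
    unfold kdim
    refine LinearEquiv.finrank_eq
      ((Module.AEval.of F (Fin n → F) (toLin' x)).symm.ofSubmodules _ _ ?_)
    have h2 : toLin' (aeval x q) = aeval (toLin' x) q := by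
      have := Polynomial.aeval_algHom_apply (Matrix.toLinAlgEquiv' (R := F) (n := Fin n)) x q
      exact this.symm
    rw [h2]
    ext v
    constructor
    · rintro ⟨m, hm, rfl⟩
      exact hm
    · intro hv
      exact ⟨Module.AEval.of F (Fin n → F) (toLin' x) v, hv, rfl⟩
  obtain ⟨f⟩ := equiv_of_kdim _ _ (tors x) (tors y) (fun q => by
    have := kd x q; have := kd y q; have := h q; omega)
  let e : (Fin n → F) ≃ₗ[F] (Fin n → F) :=
    ((Module.AEval.of F (Fin n → F) (toLin' x)).trans (f.restrictScalars F)).trans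
      (Module.AEval.of F (Fin n → F) (toLin' y)).symm
  have he : ∀ v, e (toLin' x v) = toLin' y (e v) := by
    intro v
    have := f.map_smul (X : F[X]) (Module.AEval.of F (Fin n → F) (toLin' x) v)
    rw [Module.AEval.X_smul_of] at this
    have h2 := congrArg (Module.AEval.of F (Fin n → F) (toLin' y)).symm this
    rw [Module.AEval.of_symm_X_smul] at h2
    exact h2
  let u := LinearMap.toMatrix' e.toLinearMap
  have hu : IsUnit u.det := by
    rw [LinearMap.det_toMatrix']
    exact e.isUnit_det'
  refine ⟨u, hu, ?_⟩
  have : u * x = y * u := by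
    apply Matrix.toLin'.injective
    rw [Matrix.toLin'_mul, Matrix.toLin'_mul, Matrix.toLin'_toMatrix']
    exact LinearMap.ext he
  rw [this, Matrix.mul_nonsing_inv_cancel_right _ _ hu]

lemma rank_blocks {n : ℕ} (a b : Matrix (Fin n) (Fin n) F) :
    (fromBlocks a 0 0 b).rank = a.rank + b.rank := by
  have h1 := LinearMap.finrank_range_add_finrank_ker (fromBlocks a 0 0 b).mulVecLin
  have h2 := LinearMap.finrank_range_add_finrank_ker a.mulVecLin
  have h3 := LinearMap.finrank_range_add_finrank_ker b.mulVecLin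
  have h4 : Module.finrank F (LinearMap.ker (fromBlocks a 0 0 b).mulVecLin) =
      Module.finrank F (LinearMap.ker a.mulVecLin) +
      Module.finrank F (LinearMap.ker b.mulVecLin) := by
    rw [← Module.finrank_prod]
    have mem : ∀ v : Fin n ⊕ Fin n → F, v ∈ LinearMap.ker (fromBlocks a 0 0 b).mulVecLin ↔
        v ∘ Sum.inl ∈ LinearMap.ker a.mulVecLin ∧ v ∘ Sum.inr ∈ LinearMap.ker b.mulVecLin := by
      intro v
      simp only [LinearMap.mem_ker, mulVecLin_apply, fromBlocks_mulVec, zero_mulVec, add_zero,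
        zero_add]
      constructor
      · intro h
        exact ⟨funext fun i => congrFun h (Sum.inl i), funext fun i => congrFun h (Sum.inr i)⟩
      · rintro ⟨h, h'⟩
        rw [h, h']
        funext i
        cases i <;> rfl
    exact LinearEquiv.finrank_eq
      { toFun := fun v => (⟨v.1 ∘ Sum.inl, ((mem _).1 v.2).1⟩, ⟨v.1 ∘ Sum.inr, ((mem _).1 v.2).2⟩)
        invFun := fun w => ⟨Sum.elim w.1.1 w.2.1, (mem _).2 ⟨w.1.2, w.2.2⟩⟩
        map_add' := fun _ _ => rfl
        map_smul' := fun _ _ => rfl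
        left_inv := fun v => Subtype.ext (Sum.elim_comp_inl_inr v.1)
        right_inv := fun _ => rfl }
  rw [Module.finrank_fin_fun] at h2 h3
  rw [Module.finrank_fintype_fun_eq_card, Fintype.card_sum, Fintype.card_fin] at h1
  unfold Matrix.rank
  omega

lemma aeval_blocks {n : ℕ} (a b : Matrix (Fin n) (Fin n) F) (q : F[X]) :
    aeval (fromBlocks a 0 0 b) q = fromBlocks (aeval a q) 0 0 (aeval b q) := by
  induction q using Polynomial.induction_on' with
  | add p q hp hq => simp [hp, hq, fromBlocks_add]
  | monomial k c =>
    simp [aeval_monomial, fromBlocks_diagonal_pow, ← Algebra.smul_def, fromBlocks_smul]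

lemma aeval_tr {n : ℕ} (a : Matrix (Fin n) (Fin n) F) (q : F[X]) :
    aeval aᵀ q = (aeval a q)ᵀ := by
  induction q using Polynomial.induction_on' with
  | add p q hp hq => simp [hp, hq]
  | monomial k c =>
    simp [aeval_monomial, ← Algebra.smul_def, transpose_pow]

lemma aeval_comm {m : Type*} [Fintype m] [DecidableEq m] (a b h : Matrix m m F)
    (hab : b * h = h * a) (q : F[X]) : aeval b q * h = h * aeval a q := by
  have hp : ∀ k : ℕ, b ^ k * h = h * a ^ k := by
    intro k
    exact (SemiconjBy.pow_right (show SemiconjBy h a b from hab.symm) k).symm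
  induction q using Polynomial.induction_on' with
  | add p q hp hq => simp [hp, hq, add_mul, mul_add]
  | monomial k c =>
    simp [aeval_monomial, ← Algebra.smul_def, hp]
end

/-- If h₁ diag(x,1) h₂⁻¹ = diag(y,1) for symplectic h₁, h₂, then x and y are conjugate
in GL_n(F). -/
theorem stmt3 (F : Type*) [Field F] (n : ℕ)
    (x y : Matrix (Fin n) (Fin n) F) (hx : IsUnit x.det) (hy : IsUnit y.det)
    (h₁ h₂ : Matrix (Fin n ⊕ Fin n) (Fin n ⊕ Fin n) F)
    (hh₁ : h₁ᵀ * JmatF n F * h₁ = JmatF n F)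
    (hh₂ : h₂ᵀ * JmatF n F * h₂ = JmatF n F)
    (horb : h₁ * Matrix.fromBlocks x 0 0 1 * h₂⁻¹ = Matrix.fromBlocks y 0 0 1) :
    ∃ u : Matrix (Fin n) (Fin n) F, IsUnit u.det ∧ u * x * u⁻¹ = y := by
  have hJJ : JmatF n F * -JmatF n F = 1 := by
    simp [JmatF, fromBlocks_multiply, fromBlocks_neg]
  have hJ : IsUnit (JmatF n F).det := Matrix.isUnit_det_of_right_inverse hJJ
  have hd : IsUnit (h₂ᵀ * JmatF n F).det ∧ IsUnit h₂.det := by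
    rw [← hh₂, det_mul] at hJ
    exact IsUnit.mul_iff.1 hJ
  have hJD : ∀ z : Matrix (Fin n) (Fin n) F, JmatF n F * fromBlocks z 0 0 zᵀ =
      (fromBlocks z 0 0 1)ᵀ * JmatF n F * fromBlocks z 0 0 1 := by
    intro z
    simp [JmatF, fromBlocks_multiply, fromBlocks_transpose]
  have h1 : h₁ * fromBlocks x 0 0 1 = fromBlocks y 0 0 1 * h₂ := by
    rw [← horb, Matrix.nonsing_inv_mul_cancel_right _ _ hd.2]
  have h2 : fromBlocks y 0 0 yᵀ * h₂ = h₂ * fromBlocks x 0 0 xᵀ := by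
    have : (h₂ᵀ * JmatF n F) * (fromBlocks y 0 0 yᵀ * h₂) =
        (h₂ᵀ * JmatF n F) * (h₂ * fromBlocks x 0 0 xᵀ) := by
      calc _ = h₂ᵀ * (JmatF n F * fromBlocks y 0 0 yᵀ) * h₂ := by simp only [Matrix.mul_assoc]
        _ = (fromBlocks y 0 0 1 * h₂)ᵀ * JmatF n F * (fromBlocks y 0 0 1 * h₂) := by
          rw [hJD, transpose_mul]; simp only [Matrix.mul_assoc]
        _ = (fromBlocks x 0 0 1)ᵀ * (h₁ᵀ * JmatF n F * h₁) * fromBlocks x 0 0 1 := by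
          rw [← h1, transpose_mul]; simp only [Matrix.mul_assoc]
        _ = (h₂ᵀ * JmatF n F * h₂) * fromBlocks x 0 0 xᵀ := by rw [hh₁, hh₂, hJD]
        _ = _ := by simp only [Matrix.mul_assoc]
    have h3 := congrArg ((h₂ᵀ * JmatF n F)⁻¹ * ·) this
    simpa only [Matrix.nonsing_inv_mul_cancel_left _ _ hd.1] using h3
  apply conj_of_rank
  intro q
  have h3 := congrArg Matrix.rank (aeval_comm _ _ _ h2 q)
  rw [rank_mul_eq_left_of_isUnit_det _ _ hd.2, rank_mul_eq_right_of_isUnit_det _ _ hd.2,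
    aeval_blocks, aeval_blocks, rank_blocks, rank_blocks, aeval_tr, aeval_tr, rank_transpose,
    rank_transpose] at h3
  omega
end

section
/- The Sp_{2n}(ℝ)-orbit (under conjugation) of d(J_n) = diag(J_n, J_nᵀ) is dense in the set of all nilpotent elements of g^σ = {Z ∈ gl_{2n}(ℝ) : J Zᵀ J⁻¹ = Z}: every nilpotent Z ∈ g^σ lies in the closure (for the Euclidean topology) of {h d(J_n) h⁻¹ : h ∈ Sp_{2n}(ℝ)}. -/
open Matrix

noncomputable def Jmat (n : ℕ) : Matrix (Fin n ⊕ Fin n) (Fin n ⊕ Fin n) ℝ :=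
  Matrix.fromBlocks 0 1 (-1) 0

noncomputable def dmat (n : ℕ) (X : Matrix (Fin n) (Fin n) ℝ) :
    Matrix (Fin n ⊕ Fin n) (Fin n ⊕ Fin n) ℝ :=
  Matrix.fromBlocks X 0 0 Xᵀ

noncomputable def jordanBlock (n : ℕ) : Matrix (Fin n) (Fin n) ℝ :=
  Matrix.of fun i j => if (i : ℕ) + 1 = (j : ℕ) then 1 else 0

theorem aux_flag {V : Type*} [AddCommGroup V] [Module ℝ V] [FiniteDimensional ℝ V]
    (B : LinearMap.BilinForm ℝ V) (halt : ∀ x, B x x = 0) (hnd : B.Nondegenerate)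
    (hskew : ∀ x y, B x y = - B y x)
    (Z : V →ₗ[ℝ] V) (hsa : ∀ x y, B (Z x) y = B x (Z y)) (hnil : IsNilpotent Z)
    (n : ℕ) (hdim : Module.finrank ℝ V = 2 * n) :
    ∀ k, k ≤ n → ∃ e : Fin k → V, LinearIndependent ℝ e ∧ (∀ i j, B (e i) (e j) = 0) ∧
      ∀ j, ∃ c : Fin k → ℝ, (∀ i, j ≤ i → c i = 0) ∧ Z (e j) = ∑ i, c i • e i := by
  intro k
  induction k with
  | zero =>
    intro _
    exact ⟨Fin.elim0, linearIndependent_empty_type, fun i => i.elim0, fun i => i.elim0⟩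
  | succ k ih =>
    intro hk
    obtain ⟨e, hli, hiso, hZe⟩ := ih (by omega)
    set W := Submodule.span ℝ (Set.range e) with hW
    have hWZ : ∀ w ∈ W, Z w ∈ W := by
      intro w hw
      have : W ≤ W.comap Z := by
        rw [hW, Submodule.span_le]
        rintro _ ⟨j, rfl⟩
        obtain ⟨c, _, hc⟩ := hZe j
        show Z (e j) ∈ W
        rw [hc]
        exact Submodule.sum_mem _ fun i _ => Submodule.smul_mem _ _
          (Submodule.subset_span ⟨i, rfl⟩)
      exact this hw
    have hdW : Module.finrank ℝ W = k := by
      rw [hW, finrank_span_eq_card hli, Fintype.card_fin]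
    have hdO := LinearMap.BilinForm.finrank_orthogonal hnd W
    have hex : ∃ u ∈ B.orthogonal W, u ∉ W := by
      by_contra! hcon
      have : B.orthogonal W ≤ W := hcon
      have := Submodule.finrank_mono this
      omega
    obtain ⟨u, huO, huW⟩ := hex
    have hOZ : ∀ m, (Z ^ m) u ∈ B.orthogonal W := by
      intro m
      induction m with
      | zero => simpa using huO
      | succ m ihm =>
        rw [pow_succ', Module.End.mul_apply]
        rw [LinearMap.BilinForm.mem_orthogonal_iff] at ihm ⊢
        intro w hw
        show B w _ = 0
        rw [← hsa]
        exact ihm _ (hWZ w hw)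
    have hex2 : ∃ m, (Z ^ m) u ∈ W := by
      obtain ⟨N, hN⟩ := hnil
      exact ⟨N, by simp [hN]⟩
    classical
    obtain ⟨m, hm, hmin⟩ : ∃ m, (Z ^ m) u ∈ W ∧ ∀ l < m, (Z ^ l) u ∉ W :=
      ⟨Nat.find hex2, Nat.find_spec hex2, fun l hl => Nat.find_min hex2 hl⟩
    obtain _ | m := m
    · exact absurd (by simpa using hm) huW
    set v := (Z ^ m) u with hv
    have hvW : v ∉ W := hmin m (by omega)
    have hvO := LinearMap.BilinForm.mem_orthogonal_iff.1 (hOZ m)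
    have hZv : Z v ∈ W := by rwa [pow_succ', Module.End.mul_apply] at hm
    have hev : ∀ i, B (e i) v = 0 := fun i => hvO _ (Submodule.subset_span ⟨i, rfl⟩)
    refine ⟨Fin.snoc e v, linearIndependent_finSnoc.2 ⟨hli, hvW⟩, ?_, ?_⟩
    · intro i j
      induction i using Fin.lastCases with
      | last =>
        induction j using Fin.lastCases with
        | last => simp [halt]
        | cast j => simp [hskew v, hev]
      | cast i =>
        induction j using Fin.lastCases with
        | last => simp [hev]
        | cast j => simp [hiso]
    · intro j
      induction j using Fin.lastCases with
      | last =>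
        obtain ⟨c, hc⟩ := (Submodule.mem_span_range_iff_exists_fun ℝ).1 hZv
        refine ⟨Fin.snoc c 0, ?_, ?_⟩
        · intro i hi
          rw [Fin.last_le_iff] at hi
          simp [hi]
        · simp [Fin.sum_univ_castSucc, hc]
      | cast j =>
        obtain ⟨c, hc0, hc⟩ := hZe j
        refine ⟨Fin.snoc c 0, ?_, ?_⟩
        · intro i
          induction i using Fin.lastCases with
          | last => simp
          | cast i => simpa using hc0 i
        · simp [Fin.sum_univ_castSucc, hc]

theorem aux_jordan (n : ℕ) (Y : Matrix (Fin n) (Fin n) ℝ) (h0 : ∀ i j, j ≤ i → Y i j = 0)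
    (h1 : ∀ i j : Fin n, (i : ℕ) + 1 = j → Y i j ≠ 0) :
    ∃ g : Matrix (Fin n) (Fin n) ℝ, IsUnit g.det ∧ Y * g = g * jordanBlock n := by
  obtain _ | m := n
  · exact ⟨1, by simp, by ext i; exact i.elim0⟩
  have key : ∀ k : ℕ, (∀ i : Fin (m+1), m < (i : ℕ) + k → (Y ^ k) i (Fin.last m) = 0) ∧
      (∀ i : Fin (m+1), (i : ℕ) + k = m → (Y ^ k) i (Fin.last m) ≠ 0) := by
    intro k
    induction k with
    | zero =>
      constructor
      · intro i hi; omega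
      · intro i hi
        have : i = Fin.last m := Fin.ext (by simpa using hi)
        simp [this]
    | succ k ih =>
      constructor
      · intro i hi
        rw [pow_succ', Matrix.mul_apply]
        refine Finset.sum_eq_zero fun j _ => ?_
        by_cases hij : j ≤ i
        · rw [h0 i j hij, zero_mul]
        · rw [ih.1 j (by rw [Fin.le_def] at hij; omega), mul_zero]
      · intro i hi
        rw [pow_succ', Matrix.mul_apply]
        have hlt : (i : ℕ) + 1 < m + 1 := by omega
        rw [Finset.sum_eq_single (⟨i + 1, hlt⟩ : Fin (m+1))]
        · exact mul_ne_zero (h1 _ _ rfl) (ih.2 _ (by simp only; omega))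
        · intro j _ hj
          by_cases hij : j ≤ i
          · rw [h0 i j hij, zero_mul]
          · have : (j : ℕ) ≠ i + 1 := fun h => hj (Fin.ext h)
            rw [ih.1 j (by rw [Fin.le_def] at hij; omega), mul_zero]
        · simp
  refine ⟨Matrix.of fun i j => (Y ^ (m - (j : ℕ))) i (Fin.last m), ?_, ?_⟩
  · rw [Matrix.det_of_isUpperTriangular]
    · rw [isUnit_iff_ne_zero, Finset.prod_ne_zero_iff]
      intro i _
      exact (key _).2 i (by omega)
    · intro i j hij
      simp only [id] at hij
      rw [Fin.lt_def] at hij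
      exact (key _).1 i (by omega)
  · ext i j
    have hL : (Y * Matrix.of fun i (j : Fin (m+1)) => (Y ^ (m - (j : ℕ))) i (Fin.last m)) i j
        = (Y ^ (m - (j : ℕ) + 1)) i (Fin.last m) := by
      rw [pow_succ', Matrix.mul_apply, Matrix.mul_apply]; rfl
    rw [hL, Matrix.mul_apply]
    simp only [jordanBlock, Matrix.of_apply]
    by_cases hj : (j : ℕ) = 0
    · rw [(key _).1 i (by omega), Finset.sum_eq_zero]
      intro k _
      rw [if_neg (by omega), mul_zero]
    · have hlt : (j : ℕ) - 1 < m + 1 := by omega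
      rw [Finset.sum_eq_single (⟨j - 1, hlt⟩ : Fin (m+1))]
      · rw [if_pos (by simp only; omega), mul_one]
        have : m - (j : ℕ) + 1 = m - ((j : ℕ) - 1) := by omega
        rw [this]
      · intro k _ hk
        rw [if_neg, mul_zero]
        intro h
        exact hk (Fin.ext (by simp only; omega))
      · simp

theorem aux_solve (n : ℕ) (A : Matrix (Fin n) (Fin n) ℝ) (hA : Aᵀ = -A) :
    ∃ S : Matrix (Fin n) (Fin n) ℝ, Sᵀ = S ∧
      jordanBlock n * S - S * (jordanBlock n)ᵀ = A := by
  suffices h : ∃ S : Matrix (Fin n) (Fin n) ℝ,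
      jordanBlock n * S - S * (jordanBlock n)ᵀ = A by
    obtain ⟨S, hS⟩ := h
    refine ⟨(1/2 : ℝ) • (S + Sᵀ), by simp [add_comm], ?_⟩
    have h2 : jordanBlock n * Sᵀ - Sᵀ * (jordanBlock n)ᵀ = A := by
      have := congrArg Matrix.transpose hS
      rw [hA, Matrix.transpose_sub, Matrix.transpose_mul, Matrix.transpose_mul,
        Matrix.transpose_transpose] at this
      rw [← neg_sub, this, neg_neg]
    have h3 : jordanBlock n * ((1/2 : ℝ) • (S + Sᵀ)) - ((1/2 : ℝ) • (S + Sᵀ)) * (jordanBlock n)ᵀ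
      = (1/2 : ℝ) • ((jordanBlock n * S - S * (jordanBlock n)ᵀ) +
        (jordanBlock n * Sᵀ - Sᵀ * (jordanBlock n)ᵀ)) := by
      rw [Matrix.mul_smul, Matrix.smul_mul, Matrix.mul_add, Matrix.add_mul, ← smul_sub]
      congr 1; abel
    rw [h3, hS, h2, ← two_smul ℝ A, smul_smul]; norm_num
  let b : ℕ → ℕ → ℝ := fun i j => if h : i < n ∧ j < n then A ⟨i, h.1⟩ ⟨j, h.2⟩ else 0
  have hb : ∀ i j, b i j = - b j i := by
    intro i j
    by_cases h : i < n ∧ j < n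
    · have := congrFun (congrFun hA ⟨j, h.2⟩) ⟨i, h.1⟩
      simp only [b, dif_pos h, dif_pos h.symm]
      simpa using this
    · have h' : ¬ (j < n ∧ i < n) := fun h' => h h'.symm
      simp only [b, dif_neg h, dif_neg h', neg_zero]
  have hbi : ∀ i j, n ≤ i → b i j = 0 := fun i j h => dif_neg (by omega)
  have hbj : ∀ i j, n ≤ j → b i j = 0 := fun i j h => dif_neg (by omega)
  let s : ℕ → ℕ → ℝ := fun i j => ∑ k ∈ Finset.range i, b k (i + j - 1 - k)
  have hs : ∀ i j, s (i+1) j - s i (j+1) = b i j := by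
    intro i j
    simp only [s]
    rw [Finset.sum_range_succ]
    have : i + 1 + j - 1 - i = j := by omega
    rw [this]
    have : ∀ k, i + 1 + j - 1 - k = i + (j + 1) - 1 - k := by intro k; omega
    simp only [this]; ring
  have hsj : ∀ i, s i n = 0 := by
    intro i
    refine Finset.sum_eq_zero fun k hk => hbj _ _ ?_
    rw [Finset.mem_range] at hk; omega
  have hsi : ∀ j, 0 < n → s n j = 0 := by
    intro j hn
    have e1 : s n j = ∑ k ∈ Finset.range (n + j - 1 + 1), b k (n + j - 1 - k) := by
      simp only [s]
      refine Finset.sum_subset (fun k hk => ?_) (fun k _ hk => ?_)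
      · rw [Finset.mem_range] at *; omega
      · rw [Finset.mem_range] at hk; exact hbi _ _ (by omega)
    have e2 : s n j = - s n j := by
      conv_rhs => rw [e1, ← Finset.sum_range_reflect]
      rw [e1, ← Finset.sum_neg_distrib]
      refine Finset.sum_congr rfl fun k hk => ?_
      rw [Finset.mem_range] at hk
      rw [hb]
      congr 2 <;> omega
    linarith
  refine ⟨Matrix.of fun i j => s i j, ?_⟩
  ext i j
  have hL : (jordanBlock n * Matrix.of fun (i j : Fin n) => s i j) i j = s (i+1) j := by
    rw [Matrix.mul_apply]
    simp only [jordanBlock, Matrix.of_apply]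
    by_cases hi : (i : ℕ) + 1 < n
    · rw [Finset.sum_eq_single (⟨i + 1, hi⟩ : Fin n)]
      · simp
      · intro k _ hk
        rw [if_neg, zero_mul]
        exact fun h => hk (Fin.ext h.symm)
      · simp
    · have : (i : ℕ) + 1 = n := by omega
      rw [this, hsi _ (by omega), Finset.sum_eq_zero]
      intro k _
      rw [if_neg (by omega), zero_mul]
  have hR : ((Matrix.of fun (i j : Fin n) => s i j) * (jordanBlock n)ᵀ) i j = s i (j+1) := by
    rw [Matrix.mul_apply]
    simp only [jordanBlock, Matrix.of_apply, Matrix.transpose_apply]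
    by_cases hi : (j : ℕ) + 1 < n
    · rw [Finset.sum_eq_single (⟨j + 1, hi⟩ : Fin n)]
      · simp
      · intro k _ hk
        rw [if_neg, mul_zero]
        exact fun h => hk (Fin.ext h.symm)
      · simp
    · have : (j : ℕ) + 1 = n := by omega
      rw [this, hsj, Finset.sum_eq_zero]
      intro k _
      rw [if_neg (by omega), mul_zero]
  rw [Matrix.sub_apply, hL, hR, hs]
  simp [b]

theorem aux_block (n : ℕ) (Y B : Matrix (Fin n) (Fin n) ℝ) (hB : Bᵀ = -B)
    (h0 : ∀ i j, j ≤ i → Y i j = 0)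
    (h1 : ∀ i j : Fin n, (i : ℕ) + 1 = j → Y i j ≠ 0) :
    ∃ h : Matrix (Fin n ⊕ Fin n) (Fin n ⊕ Fin n) ℝ,
        hᵀ * Jmat n * h = Jmat n ∧
        Matrix.fromBlocks Y B 0 Yᵀ * h = h * dmat n (jordanBlock n) := by
  obtain ⟨g, hg, hYg⟩ := aux_jordan n Y h0 h1
  have hgi := Matrix.mul_nonsing_inv g hg
  have hig := Matrix.nonsing_inv_mul g hg
  generalize g⁻¹ = q at hgi hig
  have hA : (-(q * B * qᵀ))ᵀ = - -(q * B * qᵀ) := by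
    simp [Matrix.transpose_mul, hB, Matrix.mul_assoc]
  obtain ⟨S, hS, hSe⟩ := aux_solve n _ hA
  have hqY : q * Y = jordanBlock n * q := by
    calc q * Y = q * Y * (g * q) := by rw [hgi, Matrix.mul_one]
      _ = q * (Y * g) * q := by simp only [Matrix.mul_assoc]
      _ = (q * g) * jordanBlock n * q := by rw [hYg]; simp only [Matrix.mul_assoc]
      _ = _ := by rw [hig, Matrix.one_mul]
  have hgt : gᵀ * qᵀ = 1 := by rw [← Matrix.transpose_mul, hig, Matrix.transpose_one]
  refine ⟨Matrix.fromBlocks g (g * S) 0 qᵀ, ?_, ?_⟩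
  · rw [Jmat, Matrix.fromBlocks_transpose, Matrix.fromBlocks_multiply,
      Matrix.fromBlocks_multiply]
    congr 1
    · simp
    · simp [hgt]
    · simp [hig]
    · simp only [Matrix.transpose_mul, hS, Matrix.mul_zero, Matrix.transpose_transpose,
        Matrix.mul_one, Matrix.mul_neg, Matrix.neg_mul, zero_add, add_zero, Matrix.zero_mul]
      rw [← Matrix.mul_assoc, hig, Matrix.mul_assoc, hgt]; simp
  · rw [dmat, Matrix.fromBlocks_multiply, Matrix.fromBlocks_multiply]
    congr 1
    · simp [hYg]
    · have h3 : jordanBlock n * S = S * (jordanBlock n)ᵀ + -(q * B * qᵀ) := by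
        rw [← hSe]; abel
      rw [← Matrix.mul_assoc, hYg, Matrix.mul_assoc, h3, Matrix.mul_add]
      have : g * (-(q * B * qᵀ)) = - (B * qᵀ) := by
        rw [Matrix.mul_neg, Matrix.mul_assoc q, ← Matrix.mul_assoc g, hgi, Matrix.one_mul]
      rw [this, Matrix.mul_assoc, Matrix.mul_zero]; abel
    · simp
    · have := congrArg Matrix.transpose hqY
      simp only [Matrix.transpose_mul] at this
      simp [this]

theorem aux_JJ (n : ℕ) : Jmat n * Jmat n = -1 := by
  rw [Jmat, Matrix.fromBlocks_multiply, ← Matrix.fromBlocks_one, Matrix.fromBlocks_neg]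
  simp

theorem aux_Jt (n : ℕ) : (Jmat n)ᵀ = - Jmat n := by
  rw [Jmat, Matrix.fromBlocks_transpose, Matrix.fromBlocks_neg]
  simp

theorem aux_sp (n : ℕ) (h : Matrix (Fin n ⊕ Fin n) (Fin n ⊕ Fin n) ℝ)
    (hh : hᵀ * Jmat n * h = Jmat n) :
    h * h⁻¹ = 1 ∧ h⁻¹ * h = 1 := by
  have h1 : (- (Jmat n * hᵀ * Jmat n)) * h = 1 := by
    rw [Matrix.neg_mul, Matrix.mul_assoc (Jmat n), Matrix.mul_assoc, hh, aux_JJ, neg_neg]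
  have := Matrix.inv_eq_left_inv h1
  rw [this]
  exact ⟨mul_eq_one_comm.1 h1, h1⟩

theorem aux_normal (n : ℕ) (Z : Matrix (Fin n ⊕ Fin n) (Fin n ⊕ Fin n) ℝ)
    (hZ : Jmat n * Zᵀ = Z * Jmat n) (hnil : IsNilpotent Z) :
    ∃ (h : Matrix (Fin n ⊕ Fin n) (Fin n ⊕ Fin n) ℝ) (X B : Matrix (Fin n) (Fin n) ℝ),
      hᵀ * Jmat n * h = Jmat n ∧ Bᵀ = -B ∧ (∀ i j, j ≤ i → X i j = 0) ∧
      Z * h = h * Matrix.fromBlocks X B 0 Xᵀ := by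
  have hZ2 : Zᵀ * Jmat n = Jmat n * Z := by
    have : Jmat n * (Jmat n * Zᵀ) * Jmat n = Jmat n * (Z * Jmat n) * Jmat n := by rw [hZ]
    rw [← Matrix.mul_assoc, aux_JJ, Matrix.mul_assoc, Matrix.mul_assoc (Jmat n) (Z * Jmat n),
      Matrix.mul_assoc Z, aux_JJ] at this
    simpa using this
  have hdet : (Jmat n).det ≠ 0 := by
    intro h
    have := congrArg Matrix.det (aux_JJ n)
    rw [Matrix.det_mul, h, zero_mul, Matrix.det_neg, Matrix.det_one, mul_one] at this
    exact pow_ne_zero _ (by norm_num) this.symm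
  have hskew : ∀ x y, Matrix.toBilin' (Jmat n) x y = - Matrix.toBilin' (Jmat n) y x := by
    intro x y
    rw [Matrix.toBilin'_apply', Matrix.toBilin'_apply', Matrix.dotProduct_mulVec,
      ← Matrix.mulVec_transpose, aux_Jt, Matrix.neg_mulVec, neg_dotProduct, dotProduct_comm]
  have hnil' : IsNilpotent (Matrix.toLin' Z) := hnil.map (Matrix.toLinAlgEquiv' (R := ℝ))
  obtain ⟨e, hli, hiso, hZe⟩ := aux_flag (Matrix.toBilin' (Jmat n))
    (fun x => by have := hskew x x; linarith)
    (Matrix.nondegenerate_of_det_ne_zero hdet).toBilin' hskew (Matrix.toLin' Z)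
    (fun x y => by
      rw [Matrix.toBilin'_apply', Matrix.toBilin'_apply', Matrix.toLin'_apply,
        Matrix.toLin'_apply, Matrix.mulVec_mulVec, ← hZ2, ← Matrix.mulVec_mulVec,
        Matrix.dotProduct_mulVec x, Matrix.vecMul_transpose])
    hnil' n (by simp; omega) n le_rfl
  choose c hc0 hc using hZe
  let E : Matrix (Fin n ⊕ Fin n) (Fin n) ℝ := Matrix.of fun i j => e j i
  let X : Matrix (Fin n) (Fin n) ℝ := Matrix.of fun i j => c j i
  have hEE : Eᵀ * Jmat n * E = 0 := by
    ext i j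
    have := hiso i j
    rw [Matrix.toBilin'_apply'] at this
    rw [Matrix.mul_assoc]
    exact this
  have hZE : Z * E = E * X := by
    ext i j
    have := congrFun (hc j) i
    rw [Matrix.toLin'_apply] at this
    refine Eq.trans this ?_
    rw [Finset.sum_apply, Matrix.mul_apply]
    refine Finset.sum_congr rfl fun k _ => ?_
    simp [E, X, mul_comm]
  have hinj : Function.Injective E.mulVec := by
    rw [Matrix.mulVec_injective_iff]
    exact hli
  have hpd := (Matrix.PosDef.conjTranspose_mul_self E hinj).isUnit
  rw [Matrix.conjTranspose_eq_transpose_of_trivial, Matrix.isUnit_iff_isUnit_det] at hpd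
  have hG1 := Matrix.mul_nonsing_inv _ hpd
  have hG2 : ((Eᵀ * E)⁻¹)ᵀ = (Eᵀ * E)⁻¹ := by
    rw [Matrix.transpose_nonsing_inv, Matrix.transpose_mul, Matrix.transpose_transpose]
  generalize (Eᵀ * E)⁻¹ = G at hG1 hG2
  let F : Matrix (Fin n ⊕ Fin n) (Fin n) ℝ := -(Jmat n * E * G)
  have hEF : Eᵀ * Jmat n * F = 1 := by
    simp only [F, Matrix.mul_neg]
    rw [← Matrix.mul_assoc, ← Matrix.mul_assoc, Matrix.mul_assoc Eᵀ, aux_JJ]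
    simp [hG1]
  have hFt : Fᵀ = G * Eᵀ * Jmat n := by
    simp only [F, Matrix.transpose_neg, Matrix.transpose_mul, hG2, aux_Jt]
    simp [Matrix.mul_assoc]
  have hFE : Fᵀ * Jmat n * E = -1 := by
    have := congrArg Matrix.transpose hEF
    simp only [Matrix.transpose_mul, aux_Jt, Matrix.transpose_transpose,
      Matrix.transpose_one] at this
    rw [← this, ← Matrix.mul_assoc]; simp
  have hFF : Fᵀ * Jmat n * F = 0 := by
    rw [hFt, Matrix.mul_assoc (G * Eᵀ), aux_JJ]
    simp only [F, Matrix.mul_neg, Matrix.neg_mul, Matrix.mul_one, neg_neg]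
    rw [Matrix.mul_assoc G, ← Matrix.mul_assoc Eᵀ, ← Matrix.mul_assoc Eᵀ, hEE]
    simp
  let h := Matrix.fromCols E F
  have hsp : hᵀ * Jmat n * h = Jmat n := by
    simp only [h]
    rw [Matrix.transpose_fromCols, Matrix.fromRows_mul, Matrix.fromRows_mul_fromCols,
      hEE, hEF, hFE, hFF, Jmat]
  obtain ⟨hi1, hi2⟩ := aux_sp n h hsp
  obtain ⟨P, hP⟩ : ∃ P, Z * h = h * P := by
    refine ⟨h⁻¹ * Z * h, ?_⟩
    rw [Matrix.mul_assoc, ← Matrix.mul_assoc h, hi1, Matrix.one_mul]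
  have hPJ : Pᵀ * Jmat n = Jmat n * P := by
    calc Pᵀ * Jmat n = Pᵀ * (hᵀ * Jmat n * h) := by rw [hsp]
      _ = (h * P)ᵀ * Jmat n * h := by rw [Matrix.transpose_mul]; simp only [Matrix.mul_assoc]
      _ = hᵀ * (Zᵀ * Jmat n) * h := by
        rw [← hP, Matrix.transpose_mul]; simp only [Matrix.mul_assoc]
      _ = hᵀ * Jmat n * (Z * h) := by rw [hZ2]; simp only [Matrix.mul_assoc]
      _ = hᵀ * Jmat n * h * P := by rw [hP]; simp only [Matrix.mul_assoc]
      _ = _ := by rw [hsp]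
  have hhE : h * Matrix.fromRows (1 : Matrix (Fin n) (Fin n) ℝ) (0 : Matrix (Fin n) (Fin n) ℝ) = E := by
    simp only [h]
    rw [Matrix.fromCols_mul_fromRows]; simp
  have hPE : P * Matrix.fromRows (1 : Matrix (Fin n) (Fin n) ℝ) (0 : Matrix (Fin n) (Fin n) ℝ) = Matrix.fromRows X (0 : Matrix (Fin n) (Fin n) ℝ) := by
    have e1 : h * (P * Matrix.fromRows (1 : Matrix (Fin n) (Fin n) ℝ) (0 : Matrix (Fin n) (Fin n) ℝ))
        = h * Matrix.fromRows X (0 : Matrix (Fin n) (Fin n) ℝ) := by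
      rw [← Matrix.mul_assoc, ← hP, Matrix.mul_assoc, hhE, hZE]
      simp only [h]
      rw [Matrix.fromCols_mul_fromRows]; simp
    have := congrArg (fun M => h⁻¹ * M) e1
    simpa only [← Matrix.mul_assoc, hi2, Matrix.one_mul] using this
  obtain ⟨P11, P12, P21, P22, hPb⟩ : ∃ a b c d, P = Matrix.fromBlocks a b c d :=
    ⟨_, _, _, _, (Matrix.fromBlocks_toBlocks P).symm⟩
  rw [hPb, Matrix.fromBlocks_mul_fromRows] at hPE
  simp only [Matrix.mul_one, Matrix.mul_zero, add_zero] at hPE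
  obtain ⟨hp1, hp2⟩ := Matrix.fromRows_inj hPE
  subst hp1 hp2
  rw [hPb, Jmat, Matrix.fromBlocks_transpose, Matrix.fromBlocks_multiply,
    Matrix.fromBlocks_multiply, Matrix.fromBlocks_inj] at hPJ
  simp only [Matrix.mul_one, Matrix.mul_zero, Matrix.zero_mul, Matrix.one_mul, add_zero,
    zero_add, Matrix.mul_neg, Matrix.neg_mul, Matrix.transpose_zero, neg_zero] at hPJ
  obtain ⟨_, q1, q2, q3⟩ := hPJ
  refine ⟨h, X, P12, hsp, q3, fun i j hij => hc0 j i hij, ?_⟩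
  rw [hP, hPb, q1]

theorem stmt8 (n : ℕ) (Z : Matrix (Fin n ⊕ Fin n) (Fin n ⊕ Fin n) ℝ)
    (hZ : Jmat n * Zᵀ * (Jmat n)⁻¹ = Z) (hnil : IsNilpotent Z) :
    Z ∈ closure {M : Matrix (Fin n ⊕ Fin n) (Fin n ⊕ Fin n) ℝ |
      ∃ h : Matrix (Fin n ⊕ Fin n) (Fin n ⊕ Fin n) ℝ,
        hᵀ * Jmat n * h = Jmat n ∧ M = h * dmat n (jordanBlock n) * h⁻¹} := by
  have hJi : (Jmat n)⁻¹ * Jmat n = 1 := (aux_sp n (Jmat n) (by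
    rw [aux_Jt, Matrix.neg_mul, aux_JJ]; simp)).2
  have hZ1 : Jmat n * Zᵀ = Z * Jmat n := by
    conv_rhs => rw [← hZ]
    rw [Matrix.mul_assoc, hJi, Matrix.mul_one]
  obtain ⟨h, X, B, hsp, hB, hX, hZh⟩ := aux_normal n Z hZ1 hnil
  obtain ⟨hi1, hi2⟩ := aux_sp n h hsp
  let Y : ℝ → Matrix (Fin n) (Fin n) ℝ := fun t => X + t • jordanBlock n
  let f : ℝ → Matrix (Fin n ⊕ Fin n) (Fin n ⊕ Fin n) ℝ := fun t =>
    h * Matrix.fromBlocks (Y t) B 0 (Y t)ᵀ * h⁻¹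
  have hf0 : f 0 = Z := by
    simp only [f, Y, zero_smul, add_zero]
    rw [← hZh, Matrix.mul_assoc, hi1, Matrix.mul_one]
  have hfc : Continuous f := by
    have hY : Continuous Y := by fun_prop
    have : Continuous fun t => Matrix.fromBlocks (Y t) B 0 (Y t)ᵀ :=
      Continuous.matrix_fromBlocks hY continuous_const continuous_const hY.matrix_transpose
    exact (continuous_const.matrix_mul this).matrix_mul continuous_const
  have ht : Filter.Tendsto f (nhdsWithin 0 {0}ᶜ) (nhds Z) := by
    rw [← hf0]
    exact (hfc.tendsto 0).mono_left nhdsWithin_le_nhds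
  refine mem_closure_of_tendsto ht ?_
  have hev : ∀ᶠ t in nhdsWithin (0 : ℝ) {0}ᶜ, ∀ i j : Fin n, (i : ℕ) + 1 = j → Y t i j ≠ 0 := by
    rw [Filter.eventually_all]
    intro i
    rw [Filter.eventually_all]
    intro j
    by_cases hij : (i : ℕ) + 1 = j
    · have hYt : ∀ t, Y t i j = X i j + t := by
        intro t; simp [Y, jordanBlock, hij]
      by_cases hx : X i j = 0
      · filter_upwards [self_mem_nhdsWithin] with t ht _
        rw [hYt, hx, zero_add]; exact ht
      · have : ∀ᶠ t in nhds (0 : ℝ), X i j + t ≠ 0 :=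
          (continuous_const.add continuous_id).continuousAt.eventually_ne (by simpa using hx)
        filter_upwards [nhdsWithin_le_nhds this] with t ht _
        rw [hYt]; exact ht
    · exact Filter.Eventually.of_forall fun t h => absurd h hij
  filter_upwards [hev] with t ht
  obtain ⟨k, hk, hke⟩ := aux_block n (Y t) B hB (fun i j hij => by
    have : ¬ ((i : ℕ) + 1 = j) := by rw [Fin.le_def] at hij; omega
    simp [Y, jordanBlock, hX i j hij, this]) ht
  have hhk : (h * k)ᵀ * Jmat n * (h * k) = Jmat n := by
    calc (h * k)ᵀ * Jmat n * (h * k) = kᵀ * (hᵀ * Jmat n * h) * k := by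
          rw [Matrix.transpose_mul]; simp only [Matrix.mul_assoc]
      _ = _ := by rw [hsp, hk]
  refine ⟨h * k, hhk, ?_⟩
  have hh := (aux_sp n _ hhk).1
  calc f t = f t * (h * k * (h * k)⁻¹) := by rw [hh, Matrix.mul_one]
    _ = h * Matrix.fromBlocks (Y t) B 0 (Y t)ᵀ * (h⁻¹ * h) * k * (h * k)⁻¹ := by
      simp only [f, Matrix.mul_assoc]
    _ = h * (Matrix.fromBlocks (Y t) B 0 (Y t)ᵀ * k) * (h * k)⁻¹ := by
      rw [hi2, Matrix.mul_one]; simp only [Matrix.mul_assoc]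
    _ = _ := by rw [hke]; simp only [Matrix.mul_assoc]
end

section
/- There are exactly p(n) orbits of Sp_{2n}(ℂ) acting by conjugation on the nilpotent elements of g^σ = {Z ∈ gl_{2n}(ℂ) : J Zᵀ J⁻¹ = Z}, where p(n) is the number of partitions of n; equivalently, the map X ↦ d(X) = diag(X, Xᵀ) induces a bijection between nilpotent GL_n(ℂ)-conjugacy classes and nilpotent Sp_{2n}(ℂ)-orbits in g^σ. -/
open Matrix

noncomputable def JmatC (n : ℕ) : Matrix (Fin n ⊕ Fin n) (Fin n ⊕ Fin n) ℂ :=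
  Matrix.fromBlocks 0 1 (-1) 0

noncomputable def dmatC (n : ℕ) (X : Matrix (Fin n) (Fin n) ℂ) :
    Matrix (Fin n ⊕ Fin n) (Fin n ⊕ Fin n) ℂ :=
  Matrix.fromBlocks X 0 0 Xᵀ


abbrev CanMod {α : Type} (k : α → ℕ) : Type :=
  ∀ i : α, (Polynomial ℂ) ⧸ (Submodule.span (Polynomial ℂ) {(Polynomial.X : Polynomial ℂ) ^ (k i)})

def HasTy {ι α : Type} [Fintype ι] (A : Matrix ι ι ℂ) (k : α → ℕ) : Prop :=
  ∃ e : (ι → ℂ) ≃ₗ[ℂ] CanMod k, ∀ v, e (A *ᵥ v) = (Polynomial.X : Polynomial ℂ) • e v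

lemma finrank_quo (m : ℕ) : Module.finrank ℂ ((Polynomial ℂ) ⧸ (Submodule.span (Polynomial ℂ) {(Polynomial.X : Polynomial ℂ) ^ m})) = m := by
  have := finrank_quotient_span_eq_natDegree (K := ℂ) (f := (Polynomial.X : Polynomial ℂ) ^ m)
  rw [Polynomial.natDegree_X_pow] at this
  exact this

instance finite_quo (m : ℕ) : Module.Finite ℂ ((Polynomial ℂ) ⧸ (Submodule.span (Polynomial ℂ) {(Polynomial.X : Polynomial ℂ) ^ m})) := by
  exact (Polynomial.monic_X_pow m).finite_quotient

lemma finrank_can {α : Type} [Fintype α] (k : α → ℕ) : Module.finrank ℂ (CanMod k) = ∑ i, k i := by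
  rw [Module.finrank_pi_fintype]
  simp [finrank_quo]

lemma HasTy.pow {ι α : Type} [Fintype ι] [DecidableEq ι] {A : Matrix ι ι ℂ} {k : α → ℕ} 
    (e : (ι → ℂ) ≃ₗ[ℂ] CanMod k) (he : ∀ v, e (A *ᵥ v) = (Polynomial.X : Polynomial ℂ) • e v)
    (j : ℕ) : ∀ v, e ((A ^ j) *ᵥ v) = ((Polynomial.X : Polynomial ℂ)^j) • e v := by
  induction j with
  | zero => intro v; simp
  | succ j ih => 
    intro v
    rw [pow_succ, ← Matrix.mulVec_mulVec, ih, he, pow_succ, mul_smul]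

/-- multiplication by `X^j` as injection -/
lemma exists_inj (m j : ℕ) : ∃ f : ((Polynomial ℂ) ⧸ (Submodule.span (Polynomial ℂ) {(Polynomial.X : Polynomial ℂ) ^ (m - j)})) →ₗ[Polynomial ℂ] ((Polynomial ℂ) ⧸ (Submodule.span (Polynomial ℂ) {(Polynomial.X : Polynomial ℂ) ^ m})),
    Function.Injective f ∧ ∀ q, f (Submodule.Quotient.mk q) = (Polynomial.X : Polynomial ℂ)^j • Submodule.Quotient.mk q := by
  have key : ∀ q : Polynomial ℂ, (Polynomial.X : Polynomial ℂ)^m ∣ (Polynomial.X : Polynomial ℂ)^j * q ↔ (Polynomial.X : Polynomial ℂ)^(m-j) ∣ q := by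
    intro q
    rcases le_total j m with h | h
    · obtain ⟨c, rfl⟩ := Nat.exists_eq_add_of_le h
      rw [pow_add, mul_dvd_mul_iff_left (pow_ne_zero _ Polynomial.X_ne_zero)]
      simp
    · rw [Nat.sub_eq_zero_of_le h]
      simp only [pow_zero, one_dvd, iff_true]
      exact Dvd.dvd.mul_right (pow_dvd_pow _ h) _
  have hk : LinearMap.ker ((Polynomial.X : Polynomial ℂ)^j • (Submodule.mkQ (Submodule.span (Polynomial ℂ) {(Polynomial.X : Polynomial ℂ) ^ m}))) = Submodule.span (Polynomial ℂ) {(Polynomial.X : Polynomial ℂ) ^ (m - j)} := by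
    ext q
    rw [LinearMap.mem_ker, LinearMap.smul_apply, Submodule.mkQ_apply, ← Submodule.Quotient.mk_smul,
      Submodule.Quotient.mk_eq_zero, smul_eq_mul]
    have := key q
    rw [← Ideal.mem_span_singleton, ← Ideal.mem_span_singleton] at this
    exact this
  refine ⟨Submodule.liftQ _ ((Polynomial.X : Polynomial ℂ)^j • (Submodule.mkQ (Submodule.span (Polynomial ℂ) {(Polynomial.X : Polynomial ℂ) ^ m}))) hk.ge, ?_, ?_⟩
  · rw [← LinearMap.ker_eq_bot]
    exact Submodule.ker_liftQ_eq_bot _ _ _ hk.le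
  · intro q; rfl

lemma HasTy.rank {ι α : Type} [Fintype ι] [DecidableEq ι] [Fintype α] {A : Matrix ι ι ℂ} {k : α → ℕ} 
    (h : HasTy A k) (j : ℕ) : (A ^ j).rank = ∑ i, (k i - j) := by
  obtain ⟨e, he⟩ := h
  have hp := HasTy.pow e he j
  choose f hf hfq using fun i => exists_inj (k i) j
  let F : CanMod (fun i => k i - j) →ₗ[ℂ] CanMod k := 
    LinearMap.pi fun i => ((f i).restrictScalars ℂ) ∘ₗ LinearMap.proj i
  have hF : Function.Injective F := by
    intro x y hxy
    funext i
    exact hf i (congrFun hxy i)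
  have hr : (LinearMap.range (A^j).mulVecLin).map (e : (ι → ℂ) →ₗ[ℂ] CanMod k) = LinearMap.range F := by
    ext x
    constructor
    · rintro ⟨_, ⟨v, rfl⟩, rfl⟩
      choose q hq using fun i => Submodule.Quotient.mk_surjective (Submodule.span (Polynomial ℂ) {(Polynomial.X : Polynomial ℂ) ^ (k i)}) (e v i)
      refine ⟨fun i => Submodule.Quotient.mk (q i), ?_⟩
      simp only [Matrix.mulVecLin_apply, LinearEquiv.coe_coe, hp]
      funext i
      change f i (Submodule.Quotient.mk (q i)) = (Polynomial.X : Polynomial ℂ) ^ j • e v i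
      rw [hfq, hq]
    · rintro ⟨y, rfl⟩
      choose q hq using fun i => Submodule.Quotient.mk_surjective (Submodule.span (Polynomial ℂ) {(Polynomial.X : Polynomial ℂ) ^ (k i - j)}) (y i)
      refine ⟨_, ⟨e.symm (fun i => Submodule.Quotient.mk (q i)), rfl⟩, ?_⟩
      simp only [Matrix.mulVecLin_apply, LinearEquiv.coe_coe, hp]
      funext i
      rw [e.apply_symm_apply]
      change (Polynomial.X : Polynomial ℂ) ^ j • Submodule.Quotient.mk (q i) = f i (y i)
      rw [← hq, hfq]
  rw [Matrix.rank, ← LinearEquiv.finrank_map_eq e, hr, LinearMap.finrank_range_of_inj hF, finrank_can]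

lemma HasTy.exists_of_sum {ι α : Type} [Fintype ι] [DecidableEq ι] [Fintype α] (k : α → ℕ) 
    (h : ∑ i, k i = Fintype.card ι) : ∃ A : Matrix ι ι ℂ, IsNilpotent A ∧ HasTy A k := by
  have e : (ι → ℂ) ≃ₗ[ℂ] CanMod k := LinearEquiv.ofFinrankEq _ _ (by
    rw [finrank_can, h, Module.finrank_pi])
  let L : CanMod k →ₗ[ℂ] CanMod k := (LinearMap.lsmul (Polynomial ℂ) (CanMod k) Polynomial.X).restrictScalars ℂ
  let A : Matrix ι ι ℂ := LinearMap.toMatrix' ((e.symm : CanMod k →ₗ[ℂ] (ι → ℂ)) ∘ₗ L ∘ₗ (e : (ι → ℂ) →ₗ[ℂ] CanMod k))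
  have hA : ∀ v, e (A *ᵥ v) = (Polynomial.X : Polynomial ℂ) • e v := by
    intro v
    simp only [A, LinearMap.toMatrix'_mulVec]
    simp [L]
  refine ⟨A, ⟨∑ i, k i, ?_⟩, e, hA⟩
  have hp := HasTy.pow e hA (∑ i, k i)
  apply Matrix.toLin'.injective
  apply LinearMap.ext
  intro v
  apply e.injective
  rw [Matrix.toLin'_apply, hp]
  simp only [map_zero, LinearMap.zero_apply]
  funext i
  obtain ⟨q, hq⟩ := Submodule.Quotient.mk_surjective _ (e v i)
  rw [Pi.smul_apply, ← hq, ← Submodule.Quotient.mk_smul, Pi.zero_apply, Submodule.Quotient.mk_eq_zero, smul_eq_mul]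
  refine Ideal.mem_span_singleton.2 (Dvd.dvd.mul_right (pow_dvd_pow _ ?_) _)
  exact Finset.single_le_sum (f := k) (fun _ _ => Nat.zero_le _) (Finset.mem_univ i)

lemma HasTy.congr {ι α β : Type} [Fintype ι] {A : Matrix ι ι ℂ} {k : α → ℕ} {l : β → ℕ}
    (h : HasTy A k) (σ : β ≃ α) (hσ : ∀ i, k (σ i) = l i) : HasTy A l := by
  obtain rfl : k ∘ σ = l := funext hσ
  obtain ⟨e, he⟩ := h
  refine ⟨e.trans (LinearEquiv.piCongrLeft' ℂ _ σ.symm), fun v => ?_⟩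
  simp only [LinearEquiv.trans_apply, he]
  rfl

lemma HasTy.conj {ι α : Type} [Fintype ι] [DecidableEq ι] {A B : Matrix ι ι ℂ} {k : α → ℕ}
    (h : HasTy A k) (h' : HasTy B k) : ∃ g : Matrix ι ι ℂ, IsUnit g.det ∧ g * A = B * g := by
  obtain ⟨e, he⟩ := h
  obtain ⟨f, hf⟩ := h'
  let g := e.trans f.symm
  refine ⟨LinearMap.toMatrix' (g : (ι → ℂ) →ₗ[ℂ] (ι → ℂ)), ?_, ?_⟩
  · rw [← LinearMap.toMatrix_eq_toMatrix']; exact g.isUnit_det _ _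
  · apply Matrix.toLin'.injective
    apply LinearMap.ext
    intro v
    rw [Matrix.toLin'_mul, Matrix.toLin'_mul]
    simp only [Matrix.toLin'_toMatrix', LinearMap.comp_apply, Matrix.toLin'_apply, LinearEquiv.coe_coe]
    apply f.injective
    simp [g, he, hf]

lemma exists_HasTy {ι : Type} [Fintype ι] [DecidableEq ι] (A : Matrix ι ι ℂ) (hA : IsNilpotent A) :
    ∃ (α : Type) (_ : Fintype α) (k : α → ℕ), (∀ i, k i ≠ 0) ∧ HasTy A k := by
  let φ := Matrix.toLin' A
  have hX : Irreducible (Polynomial.X : Polynomial ℂ) := Polynomial.irreducible_X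
  have ht : Module.IsTorsion' (Module.AEval' φ) (Submonoid.powers (Polynomial.X : Polynomial ℂ)) := by
    rw [Submodule.isTorsion'_powers_iff]
    intro x
    obtain ⟨N, hN⟩ := hA
    refine ⟨N, ?_⟩
    obtain ⟨v, rfl⟩ := (Module.AEval'.of φ).surjective x
    rw [Module.AEval'.X_pow_smul_of]
    have : φ ^ N = 0 := by
      simp only [φ]
      rw [← Matrix.toLin'_pow, hN, map_zero]
    rw [this]; simp
  obtain ⟨d, k, ⟨E⟩⟩ := Module.torsion_by_prime_power_decomposition hX ht
  classical
  let E2 := E.trans (DirectSum.linearEquivFunOnFintype (Polynomial ℂ) (Fin d) _)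
  let k' : {i : Fin d // k i ≠ 0} → ℕ := fun i => k i.1
  let P : CanMod k →ₗ[Polynomial ℂ] CanMod k' := LinearMap.pi fun i => LinearMap.proj i.1
  have hs : ∀ i, k i = 0 → Subsingleton ((Polynomial ℂ) ⧸ (Submodule.span (Polynomial ℂ) {(Polynomial.X : Polynomial ℂ) ^ (k i)})) := by
    intro i hi
    rw [Submodule.Quotient.subsingleton_iff, hi, pow_zero]
    exact Ideal.span_singleton_one
  have hP : Function.Bijective P := by
    constructor
    · intro x y hxy
      funext i
      by_cases hi : k i = 0
      · have := hs i hi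
        exact Subsingleton.elim _ _
      · exact congrFun hxy ⟨i, hi⟩
    · intro y
      refine ⟨fun i => if hi : k i ≠ 0 then y ⟨i, hi⟩ else 0, ?_⟩
      funext i
      change (if hi : k i.1 ≠ 0 then y ⟨i.1, hi⟩ else 0) = y i
      rw [dif_pos i.2]
  let E3 : Module.AEval' φ ≃ₗ[Polynomial ℂ] CanMod k' := E2.trans (LinearEquiv.ofBijective P hP)
  refine ⟨{i : Fin d // k i ≠ 0}, inferInstance, k', fun i => i.2, 
    (Module.AEval'.of φ).trans (E3.restrictScalars ℂ), ?_⟩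
  intro v
  simp only [LinearEquiv.trans_apply, LinearEquiv.restrictScalars_apply]
  rw [← map_smul, Module.AEval'.X_smul_of]
  rfl

lemma rho_count {α : Type} [Fintype α] (k : α → ℕ) (j : ℕ) :
    ∑ i, (k i - j) + ∑ i, (k i - (j+2)) = 2 * ∑ i, (k i - (j+1)) + Fintype.card {i // k i = j+1} := by
  classical
  rw [Fintype.card_subtype, Finset.card_filter, Finset.mul_sum, ← Finset.sum_add_distrib, ← Finset.sum_add_distrib]
  refine Finset.sum_congr rfl fun i _ => ?_
  split_ifs <;> omega

lemma equiv_of_rho {α β : Type} [Fintype α] [Fintype β] (k : α → ℕ) (l : β → ℕ)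
    (hk : ∀ i, k i ≠ 0) (hl : ∀ i, l i ≠ 0) (h : ∀ j, ∑ i, (k i - j) = ∑ i, (l i - j)) :
    ∃ σ : β ≃ α, ∀ i, k (σ i) = l i := by
  classical
  have hc : ∀ c, Nonempty ({b // l b = c} ≃ {a // k a = c}) := by
    intro c
    rw [← Fintype.card_eq]
    rcases c with _ | j
    · have : IsEmpty {b // l b = 0} := ⟨fun i => hl _ i.2⟩
      have : IsEmpty {a // k a = 0} := ⟨fun i => hk _ i.2⟩
      simp
    · have h1 := rho_count k j
      have h2 := rho_count l j
      rw [h, h, h] at h1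
      omega
  refine ⟨Equiv.ofFiberEquiv fun c => (hc c).some, fun i => ?_⟩
  exact Equiv.ofFiberEquiv_map _ i

lemma conj_of_rank_s16 {ι : Type} [Fintype ι] [DecidableEq ι] (A B : Matrix ι ι ℂ) (hA : IsNilpotent A)
    (hB : IsNilpotent B) (h : ∀ j, (A ^ j).rank = (B ^ j).rank) :
    ∃ g : Matrix ι ι ℂ, IsUnit g.det ∧ g * A = B * g := by
  obtain ⟨α, _, k, hk, hAk⟩ := exists_HasTy A hA
  obtain ⟨β, _, l, hl, hBl⟩ := exists_HasTy B hB
  obtain ⟨σ, hσ⟩ := equiv_of_rho k l hk hl (fun j => by rw [← hAk.rank, ← hBl.rank, h])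
  exact (hAk.congr σ hσ).conj hBl
lemma rank_fromBlocks_diag {m : Type} [Fintype m] [DecidableEq m] (A B : Matrix m m ℂ) :
    (fromBlocks A 0 0 B).rank = A.rank + B.rank := by
  let e := LinearEquiv.sumArrowLequivProdArrow m m ℂ ℂ
  let F : (LinearMap.range A.mulVecLin × LinearMap.range B.mulVecLin) →ₗ[ℂ] (m → ℂ) × (m → ℂ) :=
    LinearMap.prodMap (Submodule.subtype _) (Submodule.subtype _)
  have hF : Function.Injective F := by
    rintro ⟨x, y⟩ ⟨x', y'⟩ h
    simp only [F, LinearMap.prodMap_apply, Prod.mk.injEq] at h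
    exact Prod.ext (Subtype.ext h.1) (Subtype.ext h.2)
  have hr : (LinearMap.range (fromBlocks A 0 0 B).mulVecLin).map (e : (m ⊕ m → ℂ) →ₗ[ℂ] _) = LinearMap.range F := by
    simp only [F]
    rw [LinearMap.range_prodMap, Submodule.range_subtype, Submodule.range_subtype]
    ext ⟨x, y⟩
    constructor
    · rintro ⟨_, ⟨v, rfl⟩, h⟩
      rw [← h]
      constructor
      · refine ⟨v ∘ Sum.inl, ?_⟩
        funext i
        simp [e, fromBlocks_mulVec]
      · refine ⟨v ∘ Sum.inr, ?_⟩
        funext i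
        simp [e, fromBlocks_mulVec]
    · rintro ⟨⟨v, rfl⟩, ⟨w, rfl⟩⟩
      refine ⟨_, ⟨Sum.elim v w, rfl⟩, ?_⟩
      refine Prod.ext ?_ ?_ <;> funext i <;> simp [e, fromBlocks_mulVec]
  rw [Matrix.rank, ← LinearEquiv.finrank_map_eq e, hr, LinearMap.finrank_range_of_inj hF, Module.finrank_prod]
  rfl

lemma even_rank_skew {ι : Type} [Fintype ι] [DecidableEq ι] (A : Matrix ι ι ℂ) (hA : Aᵀ = -A) : Even A.rank := by
  obtain ⟨W, hW⟩ := Submodule.exists_isCompl (LinearMap.ker A.mulVecLin)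
  have hd : Module.finrank ℂ W = A.rank := by
    have h1 := Submodule.finrank_add_eq_of_isCompl hW
    have h2 := LinearMap.finrank_range_add_finrank_ker A.mulVecLin
    rw [Matrix.rank]; omega
  let b := Module.finBasisOfFinrankEq ℂ W hd
  let P : Matrix ι (Fin A.rank) ℂ := Matrix.of fun i j => (b j : ι → ℂ) i
  have hPc : ∀ c, P *ᵥ c = ((∑ j, c j • b j : W) : ι → ℂ) := by
    intro c
    funext i
    simp [P, Matrix.mulVec, dotProduct, Finset.sum_apply, mul_comm]
  have hdet : (Pᵀ * A * P).det ≠ 0 := by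
    intro h0
    obtain ⟨c, hc, hc0⟩ := Matrix.exists_mulVec_eq_zero_iff.2 h0
    set w : W := ∑ j, c j • b j with hw
    have hu : ∀ u : W, (u : ι → ℂ) ⬝ᵥ (A *ᵥ (w : ι → ℂ)) = 0 := by
      intro u
      have : (u : ι → ℂ) = P *ᵥ (b.repr u) := by
        rw [hPc, b.sum_repr]
      rw [this, hw, ← hPc]
      rw [← Matrix.vecMul_transpose, ← Matrix.dotProduct_mulVec, Matrix.mulVec_mulVec, Matrix.mulVec_mulVec, hc0, dotProduct_zero]
    have hk : ∀ u ∈ LinearMap.ker A.mulVecLin, u ⬝ᵥ (A *ᵥ (w : ι → ℂ)) = 0 := by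
      intro u hu
      have : A *ᵥ u = 0 := hu
      rw [Matrix.dotProduct_mulVec, ← Matrix.mulVec_transpose, hA, Matrix.neg_mulVec, this]
      simp
    have hAw : A *ᵥ (w : ι → ℂ) = 0 := by
      rw [← dotProduct_eq_zero_iff]
      intro u
      rw [dotProduct_comm]
      have : u ∈ LinearMap.ker A.mulVecLin ⊔ W := by rw [hW.sup_eq_top]; trivial
      obtain ⟨x, hx, y, hy, rfl⟩ := Submodule.mem_sup.1 this
      rw [add_dotProduct, hk x hx, hu ⟨y, hy⟩, add_zero]
    have hw0 : w = 0 := by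
      have := Submodule.disjoint_def.1 hW.disjoint (w : ι → ℂ) hAw w.2
      exact Subtype.ext this
    apply hc
    funext j
    exact (Fintype.linearIndependent_iff.1 b.linearIndependent) c (hw ▸ hw0) j
  have ht : (Pᵀ * A * P)ᵀ = -(Pᵀ * A * P) := by
    simp [Matrix.transpose_mul, hA, Matrix.mul_assoc]
  have := congrArg Matrix.det ht
  rw [Matrix.det_transpose, Matrix.det_neg, Fintype.card_fin] at this
  by_contra hodd
  rw [Nat.not_even_iff_odd] at hodd
  rw [hodd.neg_one_pow] at this
  apply hdet
  linear_combination (1/2) * this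

lemma poly_sqrt (s : Multiset ℂ) (hs : (0:ℂ) ∉ s) : ∃ p : Polynomial ℂ,
    (s.map (fun a => Polynomial.X - Polynomial.C a)).prod ∣ p ^ 2 - Polynomial.X := by
  induction s using Multiset.induction_on with
  | empty => exact ⟨0, by simp⟩
  | cons a s ih =>
    obtain ⟨p, q, hq⟩ := ih (fun h => hs (Multiset.mem_cons_of_mem h))
    have ha : a ≠ 0 := fun h => hs (by simp [h])
    rw [Multiset.map_cons, Multiset.prod_cons]
    set m := (s.map (fun a => Polynomial.X - Polynomial.C a)).prod with hm
    have hc : ∃ c : ℂ, q.eval a + 2 * c * p.eval a + c^2 * m.eval a = 0 := by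
      by_cases h : m.eval a = 0
      · have hp : p.eval a ≠ 0 := by
          intro hp
          have := congrArg (Polynomial.eval a) hq
          simp [hp, h] at this
          exact ha this
        refine ⟨- q.eval a / (2 * p.eval a), ?_⟩
        rw [h]; field_simp; ring
      · obtain ⟨r, hr⟩ := IsAlgClosed.exists_pow_nat_eq (p.eval a ^2 - q.eval a * m.eval a) (n := 2) (by norm_num)
        refine ⟨(- p.eval a + r) / m.eval a, ?_⟩
        field_simp
        linear_combination hr
    obtain ⟨c, hc⟩ := hc
    have : Polynomial.X - Polynomial.C a ∣ q + 2 * Polynomial.C c * p + Polynomial.C c ^ 2 * m := by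
      rw [Polynomial.dvd_iff_isRoot, Polynomial.IsRoot]
      simpa using hc
    obtain ⟨t, ht⟩ := this
    refine ⟨p + Polynomial.C c * m, t, ?_⟩
    linear_combination hq + m * ht

lemma mat_sqrt {ι : Type} [Fintype ι] [DecidableEq ι] (A : Matrix ι ι ℂ) (hA : IsUnit A.det) :
    ∃ p : Polynomial ℂ, Polynomial.aeval A p * Polynomial.aeval A p = A := by
  have hsp : A.charpoly.Splits := IsAlgClosed.splits _
  obtain ⟨p, hp⟩ := poly_sqrt A.charpoly.roots (by
    intro h
    rw [Polynomial.mem_roots (A.charpoly_monic.ne_zero), Polynomial.IsRoot, ← Polynomial.coeff_zero_eq_eval_zero] at h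
    rw [Matrix.det_eq_sign_charpoly_coeff, h] at hA
    simp at hA)
  rw [← hsp.eq_prod_roots_of_monic A.charpoly_monic] at hp
  obtain ⟨q, hq⟩ := hp
  refine ⟨p, ?_⟩
  have := congrArg (Polynomial.aeval A) hq
  rw [map_mul, Matrix.aeval_self_charpoly, zero_mul, map_sub, map_pow, Polynomial.aeval_X, sub_eq_zero, sq] at this
  exact this

lemma polar {ι : Type} [Fintype ι] [DecidableEq ι] (J Z Z' g : Matrix ι ι ℂ) (hJ : J * J = -1) (hJt : Jᵀ = -J)
    (hZ : Zᵀ * J = J * Z) (hZ' : Z'ᵀ * J = J * Z') (hg : IsUnit g.det) (h : g * Z = Z' * g) :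
    ∃ h : Matrix ι ι ℂ, hᵀ * J * h = J ∧ h * Z * h⁻¹ = Z' := by
  have hJd : IsUnit J.det := by
    refine (Matrix.isUnit_iff_isUnit_det _).1 ⟨⟨J, -J, ?_, ?_⟩, rfl⟩ <;> simp [hJ]
  set A := -J * gᵀ * J * g with hA
  have hJA : J * A = gᵀ * J * g := by
    rw [hA]; simp only [← Matrix.mul_assoc, Matrix.mul_neg, hJ, neg_neg, Matrix.one_mul]
  have hcan : ∀ M N : Matrix ι ι ℂ, J * M = J * N → M = N := by
    intro M N hMN
    have := congrArg (fun K => -J * K) hMN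
    simpa [← Matrix.mul_assoc, hJ] using this
  have hAd : IsUnit A.det := by
    rw [hA]; simp only [Matrix.det_mul, Matrix.det_transpose, Matrix.det_neg]
    exact (((((isUnit_one.neg).pow _).mul hJd).mul hg).mul hJd).mul hg
  have hAt : Aᵀ * J = J * A := by
    rw [hJA, hA]
    simp only [Matrix.transpose_mul, Matrix.transpose_neg, hJt, Matrix.transpose_transpose, neg_neg, Matrix.mul_assoc, hJ]
    simp
  have hAZ : A * Z = Z * A := by
    apply hcan
    calc J * (A * Z) = gᵀ * J * (g * Z) := by rw [← Matrix.mul_assoc, hJA, Matrix.mul_assoc]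
      _ = gᵀ * (J * Z') * g := by rw [h]; simp only [Matrix.mul_assoc]
      _ = (Z' * g)ᵀ * J * g := by rw [← hZ', Matrix.transpose_mul]; simp only [Matrix.mul_assoc]
      _ = Zᵀ * (gᵀ * J * g) := by rw [← h, Matrix.transpose_mul]; simp only [Matrix.mul_assoc]
      _ = J * (Z * A) := by rw [← hJA, ← Matrix.mul_assoc, hZ, Matrix.mul_assoc]
  obtain ⟨p, hp⟩ := mat_sqrt A hAd
  set s := Polynomial.aeval A p with hs
  have hsZ : s * Z = Z * s := by
    have : Commute Z s := by
      rw [hs]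
      have h0 : Commute Z A := hAZ.symm
      clear * - h0
      induction p using Polynomial.induction_on' with
      | add p q hp hq => rw [map_add]; exact hp.add_right hq
      | monomial n a => 
        rw [Polynomial.aeval_monomial]
        exact (show Commute Z (algebraMap ℂ _ a) from (Algebra.commutes a Z).symm).mul_right (h0.pow_right n)
    exact this.symm
  have hst : sᵀ * J = J * s := by
    have h1 : ∀ n : ℕ, (A^n)ᵀ * J = J * A^n := by
      intro n
      induction n with
      | zero => simp
      | succ n ih => rw [pow_succ, Matrix.transpose_mul, Matrix.mul_assoc, ih, ← Matrix.mul_assoc, hAt, Matrix.mul_assoc, ← pow_succ', pow_succ]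
    rw [hs]
    clear * - h1
    induction p using Polynomial.induction_on' with
    | add p q hp hq => rw [map_add, Matrix.transpose_add, Matrix.add_mul, hp, hq, Matrix.mul_add]
    | monomial n a => 
      rw [Polynomial.aeval_monomial, ← Algebra.smul_def, Matrix.transpose_smul, Matrix.smul_mul, h1, Matrix.mul_smul]
  have hsd : IsUnit s.det := by
    rw [← hp, Matrix.det_mul] at hAd
    exact isUnit_of_mul_isUnit_left hAd
  have hss : s * s⁻¹ = 1 := Matrix.mul_nonsing_inv _ hsd
  have hss' : s⁻¹ * s = 1 := Matrix.nonsing_inv_mul _ hsd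
  refine ⟨g * s⁻¹, ?_, ?_⟩
  · calc (g * s⁻¹)ᵀ * J * (g * s⁻¹) = (s⁻¹)ᵀ * (gᵀ * J * g) * s⁻¹ := by
          rw [Matrix.transpose_mul]; simp only [Matrix.mul_assoc]
      _ = (s⁻¹)ᵀ * (J * s) * (s * s⁻¹) := by rw [← hJA, ← hp]; simp only [Matrix.mul_assoc]
      _ = (s * s⁻¹)ᵀ * J := by rw [hss, ← hst, Matrix.mul_one, ← Matrix.mul_assoc, ← Matrix.transpose_mul, hss]
      _ = J := by rw [hss]; simp
  · have hd : IsUnit (g * s⁻¹).det := by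
      rw [Matrix.det_mul]; exact hg.mul ((Matrix.isUnit_nonsing_inv_det_iff).2 hsd)
    have : g * s⁻¹ * Z = Z' * (g * s⁻¹) := by
      have : s⁻¹ * Z = Z * s⁻¹ := by
        calc s⁻¹ * Z = s⁻¹ * (Z * s) * s⁻¹ := by rw [Matrix.mul_assoc, Matrix.mul_assoc, hss, Matrix.mul_one]
          _ = Z * s⁻¹ := by rw [← hsZ, ← Matrix.mul_assoc, hss', Matrix.one_mul]
      rw [Matrix.mul_assoc, this, ← Matrix.mul_assoc, h, Matrix.mul_assoc]
    rw [this, Matrix.mul_assoc, Matrix.mul_nonsing_inv _ hd, Matrix.mul_one]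

lemma exists_of_mul {ι : Type} [Fintype ι] [DecidableEq ι] (μ : Multiset ℕ) (h : μ.sum = Fintype.card ι) :
    ∃ A : Matrix ι ι ℂ, IsNilpotent A ∧ ∀ j, (A ^ j).rank = (μ.map (fun x => x - j)).sum := by
  obtain ⟨A, hA, hA'⟩ := HasTy.exists_of_sum (ι := ι) (α := μ) (fun x => (x : ℕ)) (by
    rw [← h, Multiset.sum_eq_sum_coe])
  refine ⟨A, hA, fun j => ?_⟩
  rw [hA'.rank]
  rw [← Multiset.map_univ, Finset.sum_eq_multiset_sum]

lemma exists_mul {ι : Type} [Fintype ι] [DecidableEq ι] (A : Matrix ι ι ℂ) (hA : IsNilpotent A) :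
    ∃ μ : Multiset ℕ, 0 ∉ μ ∧ ∀ j, (A ^ j).rank = (μ.map (fun x => x - j)).sum := by
  obtain ⟨α, _, k, hk, hAk⟩ := exists_HasTy A hA
  refine ⟨Finset.univ.val.map k, ?_, fun j => ?_⟩
  · simpa using hk
  · rw [hAk.rank, Multiset.map_map]; rfl

lemma mul_count (μ : Multiset ℕ) (j : ℕ) :
    (μ.map (fun x => x - j)).sum + (μ.map (fun x => x - (j+2))).sum
      = 2 * (μ.map (fun x => x - (j+1))).sum + μ.count (j+1) := by
  induction μ using Multiset.induction_on with
  | empty => simp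
  | cons a s ih =>
    simp only [Multiset.map_cons, Multiset.sum_cons, Multiset.count_cons]
    split_ifs <;> omega

lemma mul_inj (μ ν : Multiset ℕ) (hμ : 0 ∉ μ) (hν : 0 ∉ ν)
    (h : ∀ j, (μ.map (fun x => x - j)).sum = (ν.map (fun x => x - j)).sum) : μ = ν := by
  ext c
  rcases c with _ | j
  · rw [Multiset.count_eq_zero_of_notMem hμ, Multiset.count_eq_zero_of_notMem hν]
  · have h1 := mul_count μ j
    have h2 := mul_count ν j
    rw [h, h, h] at h1
    omega

lemma mul_half (μ : Multiset ℕ) (hμ : 0 ∉ μ) (h : ∀ j, Even (μ.map (fun x => x - j)).sum) :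
    ∃ ν, μ = ν + ν := by
  have hc : ∀ c, 2 * (μ.count c / 2) = μ.count c := by
    intro c
    apply Nat.two_mul_div_two_of_even
    rcases c with _ | j
    · simp [Multiset.count_eq_zero_of_notMem hμ]
    · have h1 := mul_count μ j
      have h2 : Even (2 * (μ.map (fun x => x - (j+1))).sum + μ.count (j+1)) := h1 ▸ (h j).add (h (j+2))
      exact (Nat.even_add.1 h2).1 (even_two_mul _)
  refine ⟨∑ b ∈ μ.toFinset, (μ.count b / 2) • {b}, ?_⟩
  conv_lhs => rw [← Multiset.toFinset_sum_count_nsmul_eq μ]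
  rw [← Finset.sum_add_distrib]
  refine Finset.sum_congr rfl fun b _ => ?_
  rw [← add_nsmul, ← two_mul, hc]

lemma rank_of_conj {ι : Type} [Fintype ι] [DecidableEq ι] (Z Z' h : Matrix ι ι ℂ) (hh : IsUnit h.det)
    (e : h * Z * h⁻¹ = Z') (j : ℕ) : (Z ^ j).rank = (Z' ^ j).rank := by
  have h1 : SemiconjBy h Z Z' := by
    change h * Z = Z' * h
    rw [← e, Matrix.mul_assoc, Matrix.nonsing_inv_mul _ hh, Matrix.mul_one]
  have h2 : h * Z ^ j = Z' ^ j * h := h1.pow_right j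
  rw [← Matrix.rank_mul_eq_right_of_isUnit_det h _ hh, h2, Matrix.rank_mul_eq_left_of_isUnit_det h _ hh]

lemma J_sq (n : ℕ) : JmatC n * JmatC n = -1 := by
  rw [JmatC, fromBlocks_multiply]
  simp [← fromBlocks_one, fromBlocks_neg]

lemma J_tr (n : ℕ) : (JmatC n)ᵀ = -JmatC n := by
  rw [JmatC, fromBlocks_transpose]
  simp [fromBlocks_neg]

lemma J_det (n : ℕ) : IsUnit (JmatC n).det := by
  refine (Matrix.isUnit_iff_isUnit_det _).1 ⟨⟨JmatC n, -JmatC n, ?_, ?_⟩, rfl⟩ <;> simp [J_sq]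

lemma JmatC_inv (n : ℕ) : (JmatC n)⁻¹ = -JmatC n := by
  apply Matrix.inv_eq_right_inv
  simp [J_sq]

lemma sa_iff (n : ℕ) (Z : Matrix (Fin n ⊕ Fin n) (Fin n ⊕ Fin n) ℂ) :
    JmatC n * Zᵀ * (JmatC n)⁻¹ = Z ↔ Zᵀ * JmatC n = JmatC n * Z := by
  rw [JmatC_inv]
  constructor
  · intro h
    have := congrArg (fun K => JmatC n * K) h
    simpa [← Matrix.mul_assoc, J_sq] using this
  · intro h
    rw [Matrix.mul_neg, Matrix.mul_assoc, h, ← Matrix.mul_assoc, J_sq]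
    simp

lemma d_sa (n : ℕ) (X : Matrix (Fin n) (Fin n) ℂ) : (dmatC n X)ᵀ * JmatC n = JmatC n * dmatC n X := by
  simp [dmatC, JmatC, fromBlocks_transpose, fromBlocks_multiply]

lemma d_pow (n : ℕ) (X : Matrix (Fin n) (Fin n) ℂ) (j : ℕ) : dmatC n X ^ j = dmatC n (X ^ j) := by
  induction j with
  | zero => simp [dmatC]
  | succ j ih => 
    rw [pow_succ, ih, pow_succ]
    simp only [dmatC, fromBlocks_multiply, Matrix.transpose_mul]
    rw [← Matrix.transpose_mul, ← Matrix.transpose_mul, ← pow_succ, ← pow_succ']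
    simp

lemma d_rank (n : ℕ) (X : Matrix (Fin n) (Fin n) ℂ) (j : ℕ) : (dmatC n X ^ j).rank = 2 * (X ^ j).rank := by
  rw [d_pow, dmatC, rank_fromBlocks_diag, Matrix.rank_transpose, two_mul]

lemma d_nil (n : ℕ) (X : Matrix (Fin n) (Fin n) ℂ) (h : IsNilpotent X) : IsNilpotent (dmatC n X) := by
  obtain ⟨N, hN⟩ := h
  exact ⟨N, by rw [d_pow, hN]; simp [dmatC]⟩

lemma sp_det (n : ℕ) (h : Matrix (Fin n ⊕ Fin n) (Fin n ⊕ Fin n) ℂ) (hh : hᵀ * JmatC n * h = JmatC n) :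
    IsUnit h.det := by
  have := J_det n
  rw [← hh, Matrix.det_mul] at this
  exact isUnit_of_mul_isUnit_right this

lemma sp_of_rank (n : ℕ) (Z Z' : Matrix (Fin n ⊕ Fin n) (Fin n ⊕ Fin n) ℂ)
    (hZ : Zᵀ * JmatC n = JmatC n * Z) (hZ' : Z'ᵀ * JmatC n = JmatC n * Z')
    (hn : IsNilpotent Z) (hn' : IsNilpotent Z') (hr : ∀ j, (Z ^ j).rank = (Z' ^ j).rank) :
    ∃ h : Matrix (Fin n ⊕ Fin n) (Fin n ⊕ Fin n) ℂ, hᵀ * JmatC n * h = JmatC n ∧ h * Z * h⁻¹ = Z' := by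
  obtain ⟨g, hg, hgz⟩ := conj_of_rank_s16 Z Z' hn hn' hr
  exact polar _ Z Z' g (J_sq n) (J_tr n) hZ hZ' hg hgz

lemma exists_half (n : ℕ) (Z : Matrix (Fin n ⊕ Fin n) (Fin n ⊕ Fin n) ℂ)
    (hZ : Zᵀ * JmatC n = JmatC n * Z) (hn : IsNilpotent Z) :
    ∃ X : Matrix (Fin n) (Fin n) ℂ, IsNilpotent X ∧ ∀ j, (dmatC n X ^ j).rank = (Z ^ j).rank := by
  obtain ⟨μ, hμ, hr⟩ := exists_mul Z hn
  have hp : ∀ j : ℕ, (Z ^ j)ᵀ * JmatC n = JmatC n * Z ^ j := by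
    intro j
    induction j with
    | zero => simp
    | succ j ih => rw [pow_succ, Matrix.transpose_mul, Matrix.mul_assoc, ih, ← Matrix.mul_assoc, hZ, Matrix.mul_assoc, ← pow_succ', pow_succ]
  have he : ∀ j, Even (μ.map (fun x => x - j)).sum := by
    intro j
    rw [← hr, ← Matrix.rank_mul_eq_right_of_isUnit_det (JmatC n) _ (J_det n)]
    apply even_rank_skew
    rw [Matrix.transpose_mul, J_tr, Matrix.mul_neg, hp]
  obtain ⟨ν, rfl⟩ := mul_half μ hμ he
  have h0 := hr 0
  simp only [pow_zero, Matrix.rank_one, Fintype.card_sum, Fintype.card_fin, Nat.sub_zero, Multiset.map_id', Multiset.sum_add] at h0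
  obtain ⟨X, hX, hXr⟩ := exists_of_mul (ι := Fin n) ν (by rw [Fintype.card_fin]; omega)
  refine ⟨X, hX, fun j => ?_⟩
  rw [d_rank, hXr, hr, Multiset.map_add, Multiset.sum_add, two_mul]

theorem stmt16 (n : ℕ) :
    (∀ X Y : Matrix (Fin n) (Fin n) ℂ, IsNilpotent X → IsNilpotent Y →
      ((∃ u : Matrix (Fin n) (Fin n) ℂ, IsUnit u.det ∧ u * X * u⁻¹ = Y) ↔
       (∃ h : Matrix (Fin n ⊕ Fin n) (Fin n ⊕ Fin n) ℂ,
          hᵀ * JmatC n * h = JmatC n ∧ h * dmatC n X * h⁻¹ = dmatC n Y))) ∧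
    (∀ Z : Matrix (Fin n ⊕ Fin n) (Fin n ⊕ Fin n) ℂ,
      JmatC n * Zᵀ * (JmatC n)⁻¹ = Z → IsNilpotent Z →
      ∃ X : Matrix (Fin n) (Fin n) ℂ, IsNilpotent X ∧
        ∃ h : Matrix (Fin n ⊕ Fin n) (Fin n ⊕ Fin n) ℂ,
          hᵀ * JmatC n * h = JmatC n ∧ h * dmatC n X * h⁻¹ = Z) ∧
    Nat.card (Quot (fun Z₁ Z₂ :
        {Z : Matrix (Fin n ⊕ Fin n) (Fin n ⊕ Fin n) ℂ //
          JmatC n * Zᵀ * (JmatC n)⁻¹ = Z ∧ IsNilpotent Z} =>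
        ∃ h : Matrix (Fin n ⊕ Fin n) (Fin n ⊕ Fin n) ℂ,
          hᵀ * JmatC n * h = JmatC n ∧ h * Z₁.1 * h⁻¹ = Z₂.1))
      = Fintype.card (Nat.Partition n) := by
  refine ⟨?_, ?_, ?_⟩
  · intro X Y hX hY
    constructor
    · rintro ⟨u, hu, e⟩
      refine sp_of_rank n _ _ (d_sa n X) (d_sa n Y) (d_nil n X hX) (d_nil n Y hY) fun j => ?_
      rw [d_rank, d_rank, rank_of_conj X Y u hu e]
    · rintro ⟨h, hh, e⟩
      obtain ⟨g, hg, hgX⟩ := conj_of_rank_s16 X Y hX hY (fun j => by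
        have := rank_of_conj _ _ h (sp_det n h hh) e j
        rw [d_rank, d_rank] at this
        omega)
      exact ⟨g, hg, by rw [hgX, Matrix.mul_assoc, Matrix.mul_nonsing_inv _ hg, Matrix.mul_one]⟩
  · intro Z hZ hn
    rw [sa_iff] at hZ
    obtain ⟨X, hX, hr⟩ := exists_half n Z hZ hn
    exact ⟨X, hX, sp_of_rank n _ _ (d_sa n X) hZ (d_nil n X hX) hn hr⟩
  · rw [← Nat.card_eq_fintype_card]
    symm
    have hex : ∀ p : Nat.Partition n, ∃ A : Matrix (Fin n) (Fin n) ℂ, IsNilpotent A ∧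
        ∀ j, (A ^ j).rank = (p.parts.map (fun x => x - j)).sum := fun p =>
      exists_of_mul p.parts (by rw [p.parts_sum, Fintype.card_fin])
    choose A hA hAr using hex
    have hpos : ∀ p : Nat.Partition n, 0 ∉ p.parts := fun p h => lt_irrefl _ (p.parts_pos h)
    refine Nat.card_eq_of_bijective (fun p => Quot.mk _
      ⟨dmatC n (A p), (sa_iff n _).2 (d_sa n _), d_nil n _ (hA p)⟩) ⟨?_, ?_⟩
    · intro p q hpq
      have := congrArg (Quot.lift (fun Z j => (Z.1 ^ j).rank) (by
        rintro Z Z' ⟨h, hh, e⟩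
        funext j
        exact rank_of_conj _ _ h (sp_det n h hh) e j)) hpq
      apply Nat.Partition.ext
      refine mul_inj _ _ (hpos p) (hpos q) fun j => ?_
      have h2 : (dmatC n (A p) ^ j).rank = (dmatC n (A q) ^ j).rank := congrFun this j
      rw [d_rank, d_rank, hAr, hAr] at h2
      omega
    · rintro ⟨Z, hZ, hn⟩
      have hZ' := (sa_iff n _).1 hZ
      obtain ⟨X, hX, hr⟩ := exists_half n Z hZ' hn
      obtain ⟨μ, hμ, hμr⟩ := exists_mul X hX
      have h0 := hμr 0
      simp only [pow_zero, Matrix.rank_one, Fintype.card_fin, Nat.sub_zero, Multiset.map_id'] at h0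
      refine ⟨⟨μ, fun {i} hi => Nat.pos_of_ne_zero (fun h => hμ (h ▸ hi)), h0.symm⟩, ?_⟩
      apply Quot.sound
      refine sp_of_rank n _ _ (d_sa n _) hZ' (d_nil n _ (hA _)) hn fun j => ?_
      rw [← hr, d_rank, d_rank, hAr, hμr]
end
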